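/- arXiv:2509.15707 — 7 statements merged into one kernel-verified Lean document; each statement's English description precedes it below -/
import Mathlib

section
/- Let ℓ ≥ 1, j ∈ {0,…,ℓ−1}, x ∈ {0,…,2^ℓ−1} and b ∈ {0,1}. Set h = ⌊x/2^j⌋ and b′ = b ⊕ (h mod 2), where ⊕ is addition modulo 2. Then h mod 2 = x_j, and (x − 2^j·b′) mod 2^ℓ = 2^j·((h − b′) mod 2^{ℓ−j}) + (x mod 2^j), where the inner subtraction is modulo 2^{ℓ−j} and the outer one modulo 2^ℓ. Consequently T_j^ℓ(x,b) = (2^j·((⌊x/2^j⌋ − (b ⊕ x_j)) mod 2^{ℓ−j}) + (x mod 2^j), b ⊕ x_j); i.e., the bit-transfer permutation factorizes through the high/low bit splitting, a least-significant-bit extraction on the high part, and a qubit-controlled modular decrement of the high part. -/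
/-- The `i`-th binary digit of the natural number `x`. -/
def bitAt (x i : ℕ) : ℕ := x / 2 ^ i % 2

/-- The bit-transfer map `T_j^ℓ` on `{0,…,2^ℓ−1} × {0,1}`:
`T_j^ℓ(x,b) = ((x − 2^j·(b ⊕ x_j)) mod 2^ℓ, b ⊕ x_j)`. -/
def bitTransfer (ℓ j : ℕ) (p : Fin (2 ^ ℓ) × Fin 2) : Fin (2 ^ ℓ) × Fin 2 :=
  (⟨((p.1 : ℕ) + 2 ^ ℓ - 2 ^ j * (((p.2 : ℕ) + bitAt (p.1 : ℕ) j) % 2)) % 2 ^ ℓ,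
      Nat.mod_lt _ (pow_pos (by norm_num) ℓ)⟩,
   ⟨((p.2 : ℕ) + bitAt (p.1 : ℕ) j) % 2, Nat.mod_lt _ (by norm_num)⟩)

/-- Modulo `m * n`, subtracting `m * c` from `x` decrements the quotient `x / m` by `c` modulo `n`
and keeps the remainder `x % m`. -/
theorem add_mul_sub_mul_mod_mul {m n c : ℕ} (x : ℕ) (hm : 0 < m) (hc : c ≤ n) :
    (x + m * n - m * c) % (m * n) = m * ((x / m + n - c) % n) + x % m := by
  have hsub : x + m * n - m * c = x + m * (n - c) := by
    rw [Nat.mul_sub, Nat.add_sub_assoc (Nat.mul_le_mul_left m hc)]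
  rw [hsub, Nat.mod_mul, Nat.add_mul_mod_self_left, Nat.add_mul_div_left _ _ hm,
    Nat.add_sub_assoc hc, Nat.add_comm]

/-- The bit-transfer permutation factorizes through the high/low bit splitting, a
least-significant-bit extraction on the high part `h = ⌊x/2^j⌋`, and a qubit-controlled
modular decrement of the high part. Here `b′ = b ⊕ (h mod 2)`, the inner subtraction is
modulo `2^{ℓ−j}`, and the outer one modulo `2^ℓ` (both realized by adding the modulus
before subtracting, as all quantities are natural numbers). -/
theorem bitTransfer_factorization (ℓ j : ℕ) (hℓ : 1 ≤ ℓ) (hj : j < ℓ)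
    (x : Fin (2 ^ ℓ)) (b : Fin 2) :
    ((x : ℕ) / 2 ^ j) % 2 = bitAt (x : ℕ) j ∧
    ((x : ℕ) + 2 ^ ℓ - 2 ^ j * (((b : ℕ) + ((x : ℕ) / 2 ^ j) % 2) % 2)) % 2 ^ ℓ =
      2 ^ j * (((x : ℕ) / 2 ^ j + 2 ^ (ℓ - j)
          - (((b : ℕ) + ((x : ℕ) / 2 ^ j) % 2) % 2)) % 2 ^ (ℓ - j))
        + (x : ℕ) % 2 ^ j ∧
    ((bitTransfer ℓ j (x, b)).1 : ℕ) =
      2 ^ j * (((x : ℕ) / 2 ^ j + 2 ^ (ℓ - j)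
          - (((b : ℕ) + bitAt (x : ℕ) j) % 2)) % 2 ^ (ℓ - j))
        + (x : ℕ) % 2 ^ j ∧
    ((bitTransfer ℓ j (x, b)).2 : ℕ) = ((b : ℕ) + bitAt (x : ℕ) j) % 2 := by
  have key : ∀ c : ℕ, ((x : ℕ) + 2 ^ ℓ - 2 ^ j * (c % 2)) % 2 ^ ℓ =
      2 ^ j * (((x : ℕ) / 2 ^ j + 2 ^ (ℓ - j) - c % 2) % 2 ^ (ℓ - j)) + (x : ℕ) % 2 ^ j := by
    intro c
    have hc : c % 2 ≤ 2 ^ (ℓ - j) :=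
      (Nat.le_of_lt_succ (Nat.mod_lt c two_pos)).trans Nat.one_le_two_pow
    have h := add_mul_sub_mul_mod_mul (x : ℕ) (Nat.two_pow_pos j) hc
    rwa [pow_mul_pow_sub 2 hj.le] at h
  exact ⟨rfl, key _, key _, rfl⟩
end

section
/- Let ℓ ≥ 2 and let j,k ∈ {0,…,ℓ−1} with j ≠ k. Let U be a complex 4×4 matrix with entries U_{(a,c),(a′,c′)} indexed by pairs in {0,1}×{0,1}. On the complex vector space of functions on {0,…,2^ℓ−1}×{0,1}×{0,1}, with standard basis (e_{x,b₁,b₂}), define the linear maps: Ĉ_j e_{x,b₁,b₂} = e_{x′,b₁′,b₂} where (x′,b₁′) = T_j^ℓ(x,b₁); Ĉ_k e_{x,b₁,b₂} = e_{x″,b₁,b₂′} where (x″,b₂′) = T_k^ℓ(x,b₂); and Û e_{x,b₁,b₂} = Σ_{a,c∈{0,1}} U_{(a,c),(b₁,b₂)}·e_{x,a,c}. Then for every x ∈ {0,…,2^ℓ−1}: Ĉ_j^{−1} Ĉ_k^{−1} Û Ĉ_k Ĉ_j e_{x,0,0} = Σ_{a,c∈{0,1}} U_{(a,c),(x_j,x_k)}·e_{σ(x,a,c),0,0},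 where σ(x,a,c) = x − 2^j·x_j − 2^k·x_k + 2^j·a + 2^k·c is the number obtained from x by replacing its j-th binary digit by a and its k-th binary digit by c. In other words, conjugation by the two bit-transfer permutations realizes the two-qubit gate U on the j-th and k-th logical qubits of the 2^ℓ-dimensional register, with both auxiliary qubits returned to state 0. -/
/-- The `i`-th binary digit, as an element of `Fin 2`. -/
def bitF (x i : ℕ) : Fin 2 := ⟨bitAt x i, Nat.mod_lt _ (by norm_num)⟩

/-- Index set for the register `ℂ^{2^ℓ} ⊗ ℂ² ⊗ ℂ²`. -/
abbrev Reg (ℓ : ℕ) := Fin (2 ^ ℓ) × Fin 2 × Fin 2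

/-- The complex vector space of functions on `{0,…,2^ℓ−1}×{0,1}×{0,1}`. -/
abbrev V (ℓ : ℕ) := Reg ℓ → ℂ

/-- Standard basis vector `e_{x,b₁,b₂}`. -/
noncomputable def eb (ℓ : ℕ) (x : Fin (2 ^ ℓ)) (b₁ b₂ : Fin 2) : V ℓ :=
  fun p => if p = (x, b₁, b₂) then 1 else 0

/-- Linear extension of a map `g` on basis indices: `e_q ↦ e_{g q}`. -/
noncomputable def permOp {ι : Type*} [Fintype ι] [DecidableEq ι] (g : ι → ι) :
    (ι → ℂ) → (ι → ℂ) :=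
  fun f p => ∑ q, f q * (if p = g q then 1 else 0)

/-- `Ĉ_j`: the bit-transfer `T_j^ℓ` acting on `(x, b₁)`. -/
noncomputable def Cop1 (ℓ j : ℕ) : V ℓ → V ℓ :=
  permOp fun q : Reg ℓ =>
    ((bitTransfer ℓ j (q.1, q.2.1)).1, (bitTransfer ℓ j (q.1, q.2.1)).2, q.2.2)

/-- `Ĉ_k`: the bit-transfer `T_k^ℓ` acting on `(x, b₂)`. -/
noncomputable def Cop2 (ℓ k : ℕ) : V ℓ → V ℓ :=
  permOp fun q : Reg ℓ =>
    ((bitTransfer ℓ k (q.1, q.2.2)).1, q.2.1, (bitTransfer ℓ k (q.1, q.2.2)).2)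

/-- `Û`: the two-qubit gate `U` acting on the two auxiliary qubits,
`Û e_{x,b₁,b₂} = Σ_{a,c} U_{(a,c),(b₁,b₂)} e_{x,a,c}`. -/
noncomputable def UopV (ℓ : ℕ) (U : Fin 2 × Fin 2 → Fin 2 × Fin 2 → ℂ) : V ℓ → V ℓ :=
  fun f p => ∑ b₁ : Fin 2, ∑ b₂ : Fin 2, U (p.2.1, p.2.2) (b₁, b₂) * f (p.1, b₁, b₂)

/-- `σ(x,a,c)`: the number obtained from `x` by replacing its `j`-th binary digit by `a`
and its `k`-th binary digit by `c`. -/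
def sigma2 (ℓ j k : ℕ) (x : Fin (2 ^ ℓ)) (a c : Fin 2) : Fin (2 ^ ℓ) :=
  ⟨((x : ℕ) - 2 ^ j * bitAt (x : ℕ) j - 2 ^ k * bitAt (x : ℕ) k
      + 2 ^ j * (a : ℕ) + 2 ^ k * (c : ℕ)) % 2 ^ ℓ,
    Nat.mod_lt _ (pow_pos (by norm_num) ℓ)⟩

theorem bitAt_le_one (x i : ℕ) : bitAt x i ≤ 1 :=
  Nat.le_of_lt_succ (Nat.mod_lt _ (by norm_num))

theorem bitAt_add_two_pow_mul_self {y j a : ℕ} (hy : bitAt y j = 0) (ha : a < 2) :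
    bitAt (y + 2 ^ j * a) j = a := by
  unfold bitAt at *
  rw [Nat.add_mul_div_left _ _ (by positivity)]
  omega

theorem add_two_pow_mul_div_two_pow {y j i a : ℕ} (hy : bitAt y j = 0) (ha : a < 2)
    (hji : j < i) : (y + 2 ^ j * a) / 2 ^ i = y / 2 ^ i := by
  obtain ⟨d, rfl⟩ := Nat.exists_eq_add_of_lt hji
  unfold bitAt at hy
  rw [show 2 ^ (j + d + 1) = 2 ^ j * (2 * 2 ^ d) by ring, ← Nat.div_div_eq_div_mul,
    ← Nat.div_div_eq_div_mul, ← Nat.div_div_eq_div_mul, ← Nat.div_div_eq_div_mul,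
    Nat.add_mul_div_left _ _ (by positivity)]
  congr 1
  omega

theorem bitAt_add_two_pow_mul_of_ne {y j i a : ℕ} (hy : bitAt y j = 0) (ha : a < 2)
    (hij : i ≠ j) : bitAt (y + 2 ^ j * a) i = bitAt y i := by
  rcases lt_or_gt_of_ne hij with h | h
  · obtain ⟨d, rfl⟩ := Nat.exists_eq_add_of_lt h
    unfold bitAt
    rw [show 2 ^ (i + d + 1) * a = 2 ^ i * (2 * (2 ^ d * a)) by ring,
      Nat.add_mul_div_left _ _ (by positivity)]
    omega
  · unfold bitAt
    rw [add_two_pow_mul_div_two_pow hy ha h]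

theorem add_two_pow_mul_lt {y j ℓ a : ℕ} (hy : bitAt y j = 0) (ha : a < 2) (hj : j < ℓ)
    (hlt : y < 2 ^ ℓ) : y + 2 ^ j * a < 2 ^ ℓ := by
  have h := add_two_pow_mul_div_two_pow hy ha hj
  rw [Nat.div_eq_of_lt hlt] at h
  exact (Nat.div_eq_zero_iff_lt (by positivity)).1 h

theorem exists_eq_add_two_pow_mul_bitAt (x j : ℕ) :
    ∃ y, bitAt y j = 0 ∧ x = y + 2 ^ j * bitAt x j := by
  have hle : 2 ^ j * bitAt x j ≤ x :=
    (Nat.mul_le_mul_left _ (Nat.mod_le _ _)).trans (Nat.mul_div_le x (2 ^ j))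
  refine ⟨x - 2 ^ j * bitAt x j, ?_, by omega⟩
  have h : (x - 2 ^ j * bitAt x j) / 2 ^ j = x / 2 ^ j - bitAt x j :=
    Nat.sub_mul_div_of_le _ _ _ hle
  rw [bitAt, h, bitAt]
  omega

/-- Every `x` is the sum of its `j`-th and `k`-th digits and a number in which both vanish. -/
theorem exists_eq_add_two_bits (x : ℕ) {j k : ℕ} (hjk : j ≠ k) :
    ∃ y, bitAt y j = 0 ∧ bitAt y k = 0 ∧
      x = y + 2 ^ j * bitAt x j + 2 ^ k * bitAt x k := by
  obtain ⟨z, hz, hxz⟩ := exists_eq_add_two_pow_mul_bitAt x j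
  obtain ⟨y, hy, hzy⟩ := exists_eq_add_two_pow_mul_bitAt z k
  have hk : bitAt x k = bitAt z k := by
    conv_lhs => rw [hxz]
    exact bitAt_add_two_pow_mul_of_ne hz (by have := bitAt_le_one x j; omega) hjk.symm
  have hj : bitAt z j = bitAt y j := by
    conv_lhs => rw [hzy]
    exact bitAt_add_two_pow_mul_of_ne hy (by have := bitAt_le_one z k; omega) hjk
  refine ⟨y, by omega, hy, ?_⟩
  rw [hk]
  omega

theorem bitTransfer_zero {ℓ j y : ℕ} (hy : bitAt y j = 0) (a : Fin 2) (hlt : y < 2 ^ ℓ)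
    (hlt' : y + 2 ^ j * (a : ℕ) < 2 ^ ℓ) :
    bitTransfer ℓ j (⟨y + 2 ^ j * (a : ℕ), hlt'⟩, 0) = (⟨y, hlt⟩, a) := by
  have hbit : bitAt (y + 2 ^ j * (a : ℕ)) j = a := bitAt_add_two_pow_mul_self hy a.isLt
  have ha : (0 + (a : ℕ)) % 2 = a := by omega
  refine Prod.ext (Fin.ext ?_) (Fin.ext ?_)
  · simp only [bitTransfer, hbit, Fin.val_zero, ha]
    rw [show y + 2 ^ j * (a : ℕ) + 2 ^ ℓ - 2 ^ j * (a : ℕ) = y + 2 ^ ℓ by omega,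
      Nat.add_mod_right, Nat.mod_eq_of_lt hlt]
  · simp only [bitTransfer, hbit, Fin.val_zero, ha]

theorem permOp_sum_smul {ι κ : Type*} [Fintype ι] [DecidableEq ι] (g : ι → ι)
    (s : Finset κ) (c : κ → ℂ) (f : κ → ι → ℂ) :
    permOp g (∑ i ∈ s, c i • f i) = ∑ i ∈ s, c i • permOp g (f i) := by
  funext p
  simp only [permOp, Finset.sum_apply, Pi.smul_apply, smul_eq_mul, Finset.sum_mul,
    Finset.mul_sum, mul_assoc]
  exact Finset.sum_comm

theorem Cop1_eb (ℓ j : ℕ) (x : Fin (2 ^ ℓ)) (b₁ b₂ : Fin 2) :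
    Cop1 ℓ j (eb ℓ x b₁ b₂) =
      eb ℓ (bitTransfer ℓ j (x, b₁)).1 (bitTransfer ℓ j (x, b₁)).2 b₂ := by
  funext p
  simp only [Cop1, permOp, eb, ite_mul, one_mul, zero_mul, Finset.sum_ite_eq',
    Finset.mem_univ, if_true]

theorem Cop2_eb (ℓ k : ℕ) (x : Fin (2 ^ ℓ)) (b₁ b₂ : Fin 2) :
    Cop2 ℓ k (eb ℓ x b₁ b₂) =
      eb ℓ (bitTransfer ℓ k (x, b₂)).1 b₁ (bitTransfer ℓ k (x, b₂)).2 := by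
  funext p
  simp only [Cop2, permOp, eb, ite_mul, one_mul, zero_mul, Finset.sum_ite_eq',
    Finset.mem_univ, if_true]

theorem UopV_eb (ℓ : ℕ) (U : Fin 2 × Fin 2 → Fin 2 × Fin 2 → ℂ) (x : Fin (2 ^ ℓ))
    (b₁ b₂ : Fin 2) :
    UopV ℓ U (eb ℓ x b₁ b₂) = ∑ p : Fin 2 × Fin 2, U p (b₁, b₂) • eb ℓ x p.1 p.2 := by
  funext ⟨y, a, c⟩
  by_cases h : y = x
  · subst h
    fin_cases a <;> fin_cases c <;> fin_cases b₁ <;> fin_cases b₂ <;>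
      simp [UopV, eb]
  · simp [UopV, eb, h]

theorem exists_Cop2_Cop1_eb_sigma2 {ℓ j k : ℕ} (hj : j < ℓ) (hk : k < ℓ) (hjk : j ≠ k)
    (x : Fin (2 ^ ℓ)) :
    ∃ y : Fin (2 ^ ℓ), (∀ a c : Fin 2, Cop2 ℓ k (Cop1 ℓ j (eb ℓ (sigma2 ℓ j k x a c) 0 0)) =
      eb ℓ y a c) ∧ sigma2 ℓ j k x (bitF x j) (bitF x k) = x := by
  obtain ⟨y, hyj, hyk, hxy⟩ := exists_eq_add_two_bits (x : ℕ) hjk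
  have hsub : (x : ℕ) - 2 ^ j * bitAt x j - 2 ^ k * bitAt x k = y := by omega
  have hy : y < 2 ^ ℓ := by have := x.isLt; omega
  refine ⟨⟨y, hy⟩, fun a c => ?_, Fin.ext ?_⟩
  · have hc : y + 2 ^ k * (c : ℕ) < 2 ^ ℓ := add_two_pow_mul_lt hyk c.isLt hk hy
    have hcj : bitAt (y + 2 ^ k * (c : ℕ)) j = 0 := by
      rw [bitAt_add_two_pow_mul_of_ne hyk c.isLt hjk, hyj]
    have hac : y + 2 ^ k * (c : ℕ) + 2 ^ j * (a : ℕ) < 2 ^ ℓ :=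
      add_two_pow_mul_lt hcj a.isLt hj hc
    have hσ : sigma2 ℓ j k x a c = ⟨y + 2 ^ k * (c : ℕ) + 2 ^ j * (a : ℕ), hac⟩ := by
      refine Fin.ext ?_
      simp only [sigma2, hsub]
      rw [add_right_comm, Nat.mod_eq_of_lt hac]
    rw [hσ, Cop1_eb, bitTransfer_zero hcj a hc hac, Cop2_eb, bitTransfer_zero hyk c hy hc]
  · simp only [sigma2, bitF, hsub, ← hxy]
    exact Nat.mod_eq_of_lt x.isLt

/-- Conjugation by the two bit-transfer permutations realizes the two-qubit gate `U` on
the `j`-th and `k`-th logical qubits of the `2^ℓ`-dimensional register, with both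
auxiliary qubits returned to state `0`.  Here `Dj` and `Dk` are the (two-sided) inverses
`Ĉ_j^{-1}` and `Ĉ_k^{-1}`. -/
theorem twoQubit_gate_via_bitTransfer (ℓ : ℕ) (hℓ : 2 ≤ ℓ) (j k : ℕ)
    (hj : j < ℓ) (hk : k < ℓ) (hjk : j ≠ k)
    (U : Fin 2 × Fin 2 → Fin 2 × Fin 2 → ℂ)
    (Dj Dk : V ℓ → V ℓ)
    (hDj₁ : ∀ f, Dj (Cop1 ℓ j f) = f) (hDj₂ : ∀ f, Cop1 ℓ j (Dj f) = f)
    (hDk₁ : ∀ f, Dk (Cop2 ℓ k f) = f) (hDk₂ : ∀ f, Cop2 ℓ k (Dk f) = f)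
    (x : Fin (2 ^ ℓ)) :
    Dj (Dk (UopV ℓ U (Cop2 ℓ k (Cop1 ℓ j (eb ℓ x 0 0))))) =
      ∑ a : Fin 2, ∑ c : Fin 2,
        U (a, c) (bitF (x : ℕ) j, bitF (x : ℕ) k) • eb ℓ (sigma2 ℓ j k x a c) 0 0 := by
  obtain ⟨y, hy, hx⟩ := exists_Cop2_Cop1_eb_sigma2 hj hk hjk x
  have hxy : Cop2 ℓ k (Cop1 ℓ j (eb ℓ x 0 0)) = eb ℓ y (bitF x j) (bitF x k) := by
    rw [← hy, hx]
  rw [hxy, UopV_eb, ← Fintype.sum_prod_type' (f := fun a c =>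
    U (a, c) (bitF (x : ℕ) j, bitF (x : ℕ) k) • eb ℓ (sigma2 ℓ j k x a c) 0 0)]
  have hσ : Cop2 ℓ k (Cop1 ℓ j (∑ p : Fin 2 × Fin 2,
      U p (bitF x j, bitF x k) • eb ℓ (sigma2 ℓ j k x p.1 p.2) 0 0)) =
      ∑ p : Fin 2 × Fin 2, U p (bitF x j, bitF x k) • eb ℓ y p.1 p.2 := by
    simp only [← hy]
    rw [Cop1, permOp_sum_smul, Cop2, permOp_sum_smul]
  rw [← hσ, hDk₁, hDj₁]
end

section
/- Let ℓ ≥ 2 and T ≥ 1. For each t ∈ {1,…,T} let j_t,k_t ∈ {0,…,ℓ−1} with j_t ≠ k_t, and let U_t be a complex 4×4 matrix indexed by {0,1}×{0,1}. On the complex vector space of functions on {0,…,2^ℓ−1}×{0,1}×{0,1} with basis (e_{x,b₁,b₂}), define G_t = Ĉ_{j_t}^{−1} Ĉ_{k_t}^{−1} Û_t Ĉ_{k_t} Ĉ_{j_t}, where Ĉ_{j_t} permutes the basis via T_{j_t}^ℓ acting on (x,b₁), Ĉ_{k_t} via T_{k_t}^ℓ acting on (x,b₂), and Û_t e_{x,b₁,b₂}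 = Σ_{a,c} (U_t)_{(a,c),(b₁,b₂)} e_{x,a,c}. Let L_t be the 2^ℓ×2^ℓ matrix with entries (L_t)_{y,x} = (U_t)_{(y_{j_t},y_{k_t}),(x_{j_t},x_{k_t})} if y_i = x_i for all i ∉ {j_t,k_t}, and 0 otherwise (the canonical action of the two-qubit gate U_t on qubits j_t,k_t of ℓ qubits under the binary encoding). Then for every x ∈ {0,…,2^ℓ−1}: (G_T ∘ ⋯ ∘ G_1)(e_{x,0,0}) = Σ_{y=0}^{2^ℓ−1} (L_T ⋯ L_1)_{y,x}·e_{y,0,0}. This is the exact-logic core of the paper's main theorem: any circuit of T two-qubit gates on ℓ qubits is realized exactly on the 2^ℓ-dimensional register by conjugated bit-transfers, with the two auxiliary qubits acting as a catalyst. -/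
open scoped Classical

/-- The canonical action, as a `2^ℓ × 2^ℓ` matrix, of a two-qubit gate `U` on the qubits
`j` and `k` of `ℓ` qubits under the binary encoding. -/
noncomputable def logicalTwoQubitMatrix (ℓ j k : ℕ)
    (U : Fin 2 × Fin 2 → Fin 2 × Fin 2 → ℂ) :
    Matrix (Fin (2 ^ ℓ)) (Fin (2 ^ ℓ)) ℂ :=
  Matrix.of fun y x =>
    if ∀ i : ℕ, i ≠ j → i ≠ k → bitAt (y : ℕ) i = bitAt (x : ℕ) i then
      U (bitF (y : ℕ) j, bitF (y : ℕ) k) (bitF (x : ℕ) j, bitF (x : ℕ) k)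
    else 0

theorem bitAt_eq_toNat_testBit (x i : ℕ) : bitAt x i = (x.testBit i).toNat := by
  rw [Nat.toNat_testBit, bitAt]

theorem testBit_eq_of_bitAt_eq {x y i : ℕ} (h : bitAt x i = bitAt y i) :
    x.testBit i = y.testBit i := by
  rw [bitAt_eq_toNat_testBit, bitAt_eq_toNat_testBit] at h
  revert h
  cases x.testBit i <;> cases y.testBit i <;> simp

theorem fin_eq_of_bitAt_eq {ℓ : ℕ} {x y : Fin (2 ^ ℓ)} (h : ∀ i, bitAt x i = bitAt y i) :
    x = y :=
  Fin.ext (Nat.eq_of_testBit_eq fun i => testBit_eq_of_bitAt_eq (h i))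

theorem exists_fin_testBit_eq (ℓ : ℕ) (f : ℕ → Bool) :
    ∃ y : Fin (2 ^ ℓ), ∀ i < ℓ, (y : ℕ).testBit i = f i :=
  ⟨⟨Nat.ofBits fun i : Fin ℓ => f i, Nat.ofBits_lt_two_pow _⟩,
    fun i hi => Nat.testBit_ofBits_lt _ i hi⟩

theorem bitAt_eq_zero_of_le {ℓ i : ℕ} (x : Fin (2 ^ ℓ)) (hi : ℓ ≤ i) : bitAt x i = 0 := by
  have : (x : ℕ) < 2 ^ i := x.isLt.trans_le (Nat.pow_le_pow_right (by norm_num) hi)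
  simp [bitAt, Nat.div_eq_of_lt this]

theorem bitTransfer_zero_snd (ℓ j : ℕ) (x : Fin (2 ^ ℓ)) :
    (bitTransfer ℓ j (x, 0)).2 = bitF x j := by
  apply Fin.ext
  simp [bitTransfer, bitF, bitAt]

theorem bitTransfer_zero_fst_val (ℓ j : ℕ) (x : Fin (2 ^ ℓ)) :
    ((bitTransfer ℓ j (x, 0)).1 : ℕ) = 2 ^ j * (2 * (x / 2 ^ j / 2)) + x % 2 ^ j := by
  have h1 := Nat.div_add_mod (x : ℕ) (2 ^ j)
  have h2 := Nat.div_add_mod ((x : ℕ) / 2 ^ j) 2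
  have h3 : (x : ℕ) = 2 ^ j * (2 * (x / 2 ^ j / 2)) + x % 2 ^ j + 2 ^ j * (x / 2 ^ j % 2) := by
    conv_lhs => rw [← h1, ← h2]
    ring
  have hx := x.isLt
  have h4 : (x : ℕ) + 2 ^ ℓ - 2 ^ j * (x / 2 ^ j % 2) =
      (2 ^ j * (2 * (x / 2 ^ j / 2)) + x % 2 ^ j) + 2 ^ ℓ := by omega
  simp only [bitTransfer, bitAt, Fin.val_zero, zero_add, Nat.mod_mod]
  rw [h4, Nat.add_mod_right, Nat.mod_eq_of_lt (by omega)]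

theorem bitAt_bitTransfer_zero (ℓ j i : ℕ) (x : Fin (2 ^ ℓ)) :
    bitAt (bitTransfer ℓ j (x, 0)).1 i = if i = j then 0 else bitAt x i := by
  have hr : (x : ℕ) % 2 ^ j < 2 ^ j := Nat.mod_lt _ (by positivity)
  have h2 := Nat.div_add_mod (x : ℕ) (2 ^ j)
  rw [bitTransfer_zero_fst_val, bitAt_eq_toNat_testBit, bitAt_eq_toNat_testBit]
  conv_rhs => rw [← h2]
  rw [Nat.testBit_two_pow_mul_add _ hr, Nat.testBit_two_pow_mul_add _ hr]
  rcases lt_trichotomy i j with h | h | h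
  · simp [h, h.ne]
  · simp [h]
  · obtain ⟨m, rfl⟩ := Nat.exists_eq_add_of_lt h
    have : j + m + 1 - j = m + 1 := by omega
    simp [this, Nat.testBit_succ, show ¬ j + m + 1 < j by omega, show j + m + 1 ≠ j by omega]

/-- The register index obtained from `(x, 0, 0)` by transferring bit `j` of `x` to the first
auxiliary qubit and bit `k` to the second one. -/
def transferBits (ℓ j k : ℕ) (x : Fin (2 ^ ℓ)) : Reg ℓ :=
  ((bitTransfer ℓ k ((bitTransfer ℓ j (x, 0)).1, 0)).1, bitF x j, bitF x k)

theorem bitAt_transferBits_fst (ℓ j k i : ℕ) (x : Fin (2 ^ ℓ)) :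
    bitAt (transferBits ℓ j k x).1 i = if i = k then 0 else if i = j then 0 else bitAt x i := by
  rw [transferBits, bitAt_bitTransfer_zero, bitAt_bitTransfer_zero]

theorem transferBits_fst_eq_iff {ℓ j k : ℕ} {x y : Fin (2 ^ ℓ)} :
    (transferBits ℓ j k y).1 = (transferBits ℓ j k x).1 ↔
      ∀ i, i ≠ j → i ≠ k → bitAt y i = bitAt x i := by
  constructor
  · intro h i hj hk
    have := congrArg (fun z : Fin (2 ^ ℓ) => bitAt z i) h
    simpa [bitAt_transferBits_fst, hj, hk] using this
  · intro h
    apply fin_eq_of_bitAt_eq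
    intro i
    rw [bitAt_transferBits_fst, bitAt_transferBits_fst]
    split_ifs with hk hj
    · rfl
    · rfl
    · exact h i hj hk

theorem transferBits_injective (ℓ j k : ℕ) : Function.Injective (transferBits ℓ j k) := by
  intro x y h
  have h1 := transferBits_fst_eq_iff.mp (congrArg Prod.fst h)
  have h2 : bitF x j = bitF y j := congrArg (fun q : Reg ℓ => q.2.1) h
  have h3 : bitF x k = bitF y k := congrArg (fun q : Reg ℓ => q.2.2) h
  apply fin_eq_of_bitAt_eq
  intro i
  by_cases hj : i = j
  · subst hj; exact congrArg Fin.val h2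
  by_cases hk : i = k
  · subst hk; exact congrArg Fin.val h3
  exact h1 i hj hk

theorem exists_transferBits_eq {ℓ j k : ℕ} (hj : j < ℓ) (hk : k < ℓ) (hjk : j ≠ k)
    (x : Fin (2 ^ ℓ)) (a c : Fin 2) :
    ∃ y, transferBits ℓ j k y = ((transferBits ℓ j k x).1, a, c) := by
  obtain ⟨y, hy⟩ := exists_fin_testBit_eq ℓ fun i =>
    if i = j then decide (a = 1) else if i = k then decide (c = 1) else (x : ℕ).testBit i
  have hb : ∀ b : Fin 2, (decide (b = 1)).toNat = b := by decide
  refine ⟨y, Prod.ext (transferBits_fst_eq_iff.mpr fun i h1 h2 => ?_) (Prod.ext ?_ ?_)⟩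
  · by_cases hi : i < ℓ
    · rw [bitAt_eq_toNat_testBit, bitAt_eq_toNat_testBit, hy i hi, if_neg h1, if_neg h2]
    · rw [bitAt_eq_zero_of_le _ (not_lt.mp hi), bitAt_eq_zero_of_le _ (not_lt.mp hi)]
  · apply Fin.ext
    change bitAt y j = a
    rw [bitAt_eq_toNat_testBit, hy j hj, if_pos rfl, hb]
  · apply Fin.ext
    change bitAt y k = c
    rw [bitAt_eq_toNat_testBit, hy k hk, if_neg hjk.symm, if_pos rfl, hb]

/-- The vector `v ⊗ e_0 ⊗ e_0`. -/
noncomputable def withZeroAncillas {ℓ : ℕ} (v : Fin (2 ^ ℓ) → ℂ) : V ℓ :=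
  fun p => if p.2 = 0 then v p.1 else 0

theorem permOp_permOp {ι : Type*} [Fintype ι] [DecidableEq ι] (h g : ι → ι) (f : ι → ℂ) :
    permOp h (permOp g f) = permOp (h ∘ g) f := by
  funext p
  simp only [permOp, Finset.sum_mul, mul_assoc]
  rw [Finset.sum_comm]
  refine Finset.sum_congr rfl fun q _ => ?_
  rw [Finset.sum_eq_single (g q)]
  · simp
  · intro r _ hr
    simp [hr]
  · simp

theorem Cop2_Cop1_withZeroAncillas {ℓ j k : ℕ} (hjk : j ≠ k) (v : Fin (2 ^ ℓ) → ℂ)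
    (p : Reg ℓ) :
    Cop2 ℓ k (Cop1 ℓ j (withZeroAncillas v)) p =
      ∑ x, if p = transferBits ℓ j k x then v x else 0 := by
  have hF : ∀ x : Fin (2 ^ ℓ), bitF (bitTransfer ℓ j (x, 0)).1 k = bitF x k := fun x =>
    Fin.ext (by simp [bitF, bitAt_bitTransfer_zero, hjk.symm])
  rw [Cop2, Cop1, permOp_permOp, permOp, Fintype.sum_prod_type]
  refine Finset.sum_congr rfl fun x _ => ?_
  rw [Finset.sum_eq_single 0]
  · simp [withZeroAncillas, transferBits, bitTransfer_zero_snd, hF]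
    congr
  · intro b _ hb
    simp [withZeroAncillas, hb]
  · simp

theorem UopV_Cop2_Cop1_withZeroAncillas {ℓ j k : ℕ} (hj : j < ℓ) (hk : k < ℓ) (hjk : j ≠ k)
    (U : Fin 2 × Fin 2 → Fin 2 × Fin 2 → ℂ) (v : Fin (2 ^ ℓ) → ℂ) :
    UopV ℓ U (Cop2 ℓ k (Cop1 ℓ j (withZeroAncillas v))) =
      Cop2 ℓ k (Cop1 ℓ j
        (withZeroAncillas ((logicalTwoQubitMatrix ℓ j k U).mulVec v))) := by
  funext ⟨z, a, c⟩
  have hL : UopV ℓ U (Cop2 ℓ k (Cop1 ℓ j (withZeroAncillas v))) (z, a, c) =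
      ∑ x, if z = (transferBits ℓ j k x).1 then
        U (a, c) (bitF x j, bitF x k) * v x else 0 := by
    simp only [UopV, Cop2_Cop1_withZeroAncillas hjk, Finset.mul_sum]
    rw [← Fintype.sum_prod_type'
      (f := fun b₁ b₂ => ∑ x, U (a, c) (b₁, b₂) *
        if (z, b₁, b₂) = transferBits ℓ j k x then v x else 0), Finset.sum_comm]
    refine Finset.sum_congr rfl fun x _ => ?_
    rw [Finset.sum_eq_single (bitF x j, bitF x k)]
    · simp [transferBits]
      congr
    · rintro ⟨b₁, b₂⟩ _ hb
      rw [if_neg, mul_zero]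
      intro h
      exact hb (congrArg Prod.snd h)
    · simp
  rw [hL, Cop2_Cop1_withZeroAncillas hjk]
  have hR : ∀ y, (if (z, a, c) = transferBits ℓ j k y then
      (logicalTwoQubitMatrix ℓ j k U).mulVec v y else 0) =
      ∑ x, if (z, a, c) = transferBits ℓ j k y then
        logicalTwoQubitMatrix ℓ j k U y x * v x else 0 := by
    intro y
    split_ifs
    · rfl
    · simp
  simp only [hR]
  rw [Finset.sum_comm]
  refine Finset.sum_congr rfl fun x _ => ?_
  by_cases hz : z = (transferBits ℓ j k x).1
  · obtain ⟨y, hy⟩ := exists_transferBits_eq hj hk hjk x a c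
    rw [if_pos hz, Finset.sum_eq_single y]
    · have hyj : bitF y j = a := congrArg (fun q : Reg ℓ => q.2.1) hy
      have hyk : bitF y k = c := congrArg (fun q : Reg ℓ => q.2.2) hy
      rw [if_pos (by rw [hy, hz]), logicalTwoQubitMatrix, Matrix.of_apply,
        if_pos (transferBits_fst_eq_iff.mp (by rw [hy])), hyj, hyk]
    · intro w _ hw
      rw [if_neg]
      intro h
      exact hw (transferBits_injective ℓ j k (by rw [hy, ← h, hz]))
    · simp
  · rw [if_neg hz, Finset.sum_eq_zero]
    intro y _
    split_ifs with h
    · rw [logicalTwoQubitMatrix, Matrix.of_apply, if_neg, zero_mul]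
      intro hyx
      exact hz ((congrArg Prod.fst h).trans (transferBits_fst_eq_iff.mpr hyx))
    · rfl

theorem foldl_withZeroAncillas {ι : Type*} {ℓ : ℕ} (G : ι → V ℓ → V ℓ)
    (L : ι → Matrix (Fin (2 ^ ℓ)) (Fin (2 ^ ℓ)) ℂ)
    (h : ∀ t v, G t (withZeroAncillas v) = withZeroAncillas ((L t).mulVec v))
    (l : List ι) (v : Fin (2 ^ ℓ) → ℂ) :
    (l.map G).foldl (fun v g => g v) (withZeroAncillas v) =
      withZeroAncillas ((l.map L).reverse.prod.mulVec v) := by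
  induction l generalizing v with
  | nil => simp
  | cons t l ih =>
    simp [h, ih, Matrix.mulVec_mulVec]

theorem withZeroAncillas_single {ℓ : ℕ} (x : Fin (2 ^ ℓ)) :
    withZeroAncillas (Pi.single x 1) = eb ℓ x 0 0 := by
  funext ⟨y, a, c⟩
  by_cases hy : y = x <;> simp [withZeroAncillas, eb, Prod.ext_iff, hy]

theorem withZeroAncillas_eq_sum {ℓ : ℕ} (v : Fin (2 ^ ℓ) → ℂ) :
    withZeroAncillas v = ∑ y, v y • eb ℓ y 0 0 := by
  funext ⟨z, b⟩
  by_cases hb : b = 0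
  · subst hb
    simp [withZeroAncillas, eb, ← Prod.zero_eq_mk]
  · have : ∀ y, ((z, b) : Reg ℓ) ≠ (y, 0, 0) := fun y h => hb (congrArg Prod.snd h)
    simp [withZeroAncillas, eb, hb, this]

/-- Any circuit of `T` two-qubit gates on `ℓ` qubits is realized exactly on the
`2^ℓ`-dimensional register by conjugated bit-transfers, with the two auxiliary qubits
acting as a catalyst.  Gate `t` is `G_t = Ĉ_{j_t}^{−1} Ĉ_{k_t}^{−1} Û_t Ĉ_{k_t} Ĉ_{j_t}`,
where `D1 t` and `D2 t` are the (two-sided) inverses `Ĉ_{j_t}^{−1}` and `Ĉ_{k_t}^{−1}`. -/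
theorem circuit_via_bitTransfer (ℓ : ℕ) (hℓ : 2 ≤ ℓ) (T : ℕ) (hT : 1 ≤ T)
    (j k : Fin T → ℕ) (hj : ∀ t, j t < ℓ) (hk : ∀ t, k t < ℓ) (hjk : ∀ t, j t ≠ k t)
    (U : Fin T → (Fin 2 × Fin 2 → Fin 2 × Fin 2 → ℂ))
    (D1 D2 : Fin T → (V ℓ → V ℓ))
    (hD1₁ : ∀ t f, D1 t (Cop1 ℓ (j t) f) = f) (hD1₂ : ∀ t f, Cop1 ℓ (j t) (D1 t f) = f)
    (hD2₁ : ∀ t f, D2 t (Cop2 ℓ (k t) f) = f) (hD2₂ : ∀ t f, Cop2 ℓ (k t) (D2 t f) = f)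
    (x : Fin (2 ^ ℓ)) :
    ((List.ofFn fun t : Fin T =>
        fun f : V ℓ => D1 t (D2 t (UopV ℓ (U t) (Cop2 ℓ (k t) (Cop1 ℓ (j t) f)))))).foldl
        (fun v g => g v) (eb ℓ x 0 0) =
      ∑ y : Fin (2 ^ ℓ),
        ((List.ofFn fun t : Fin T => logicalTwoQubitMatrix ℓ (j t) (k t) (U t)).reverse.prod
            y x) • eb ℓ y 0 0 := by
  have hG : ∀ t v, D1 t (D2 t (UopV ℓ (U t) (Cop2 ℓ (k t) (Cop1 ℓ (j t)
      (withZeroAncillas v))))) =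
      withZeroAncillas ((logicalTwoQubitMatrix ℓ (j t) (k t) (U t)).mulVec v) := fun t v => by
    rw [UopV_Cop2_Cop1_withZeroAncillas (hj t) (hk t) (hjk t), hD2₁, hD1₁]
  rw [← withZeroAncillas_single, List.ofFn_eq_map, List.ofFn_eq_map,
    foldl_withZeroAncillas _ _ hG, withZeroAncillas_eq_sum]
  simp only [Matrix.mulVec_single_one, Matrix.col_apply]
end

section
/- Let ℓ ≥ 1, κ,Δ > 0 and ε ∈ (0, 2^{−(ℓ+1)}]. For every j ∈ {0,…,2^ℓ−1}, let ψ_j^{(2^ℓ)} denote the normalized ε-truncated approximate GKP state for dimension d = 2^ℓ and ψ_{2j}^{(2^{ℓ+1})} that for dimension d = 2^{ℓ+1} and index 2j. Then for every x ∈ ℝ: 2^{−1/4}·ψ_j^{(2^ℓ)}(x/√2) = ψ_{2j}^{(2^{ℓ+1})}(x). That is, the squeezing (dilation) unitary M_{√2} on L²(ℝ), (M_{√2} f)(x) = 2^{−1/4} f(x/√2), maps the approximate GKP state encoding j in dimension 2^ℓ exactly onto the approximate GKP state encoding 2j in dimension 2^{ℓ+1}; the embedding isometry is implemented without error. -/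
open MeasureTheory Real
open scoped Classical

/-- The peak center `c_{s,j} = √(2πd)·s + √(2π/d)·j`. -/
noncomputable def gkpCenter (d : ℕ) (j : ℕ) (s : ℤ) : ℝ :=
  Real.sqrt (2 * π * d) * s + Real.sqrt (2 * π / d) * j

/-- The (unnormalized) `ε`-truncated approximate GKP function `g_j^{(d)}`:
`g_j^{(d)}(x) = e^{−κ²s²/2}·exp(−(x − c_{s,j})²/(4πdΔ²))` if `|x − c_{s,j}| ≤ √(2πd)·ε`
for some (necessarily unique, when `ε < 1/2`) `s ∈ ℤ`, and `0` otherwise. -/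
noncomputable def gkpFun (d : ℕ) (κ Δ ε : ℝ) (j : ℕ) (x : ℝ) : ℝ :=
  if h : ∃ s : ℤ, |x - gkpCenter d j s| ≤ Real.sqrt (2 * π * d) * ε then
    Real.exp (-(κ ^ 2 * (h.choose : ℝ) ^ 2) / 2) *
      Real.exp (-(x - gkpCenter d j h.choose) ^ 2 / (4 * π * d * Δ ^ 2))
  else 0

/-- The normalized `ε`-truncated approximate GKP state `ψ_j^{(d)} = g_j^{(d)} / ‖g_j^{(d)}‖_{L²(ℝ)}`. -/
noncomputable def gkpState (d : ℕ) (κ Δ ε : ℝ) (j : ℕ) (x : ℝ) : ℝ :=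
  gkpFun d κ Δ ε j x / Real.sqrt (∫ y : ℝ, gkpFun d κ Δ ε j y ^ 2)

/-- Doubling both the dimension and the index dilates the peak centers by `√2`. -/
lemma gkpCenter_two_mul (d j : ℕ) (s : ℤ) :
    gkpCenter (2 * d) (2 * j) s = √2 * gkpCenter d j s := by
  have hs : √2 * √2 = 2 := Real.mul_self_sqrt (by norm_num)
  have h₁ : √(2 * π * ↑(2 * d)) = √2 * √(2 * π * d) := by
    rw [← Real.sqrt_mul (by norm_num)]
    congr 1
    push_cast
    ring
  have h₂ : √(2 * π / d) = √2 * √(2 * π / ↑(2 * d)) := by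
    rw [← Real.sqrt_mul (by norm_num)]
    congr 1
    push_cast
    rw [mul_div_assoc', mul_div_mul_left _ _ two_ne_zero]
  unfold gkpCenter
  rw [h₁, h₂]
  push_cast
  linear_combination (-(√(2 * π / (2 * d)) * j)) * hs

/-- Doubling both the dimension and the index dilates the truncated GKP function by `√2`. -/
lemma gkpFun_two_mul (d : ℕ) (κ Δ ε : ℝ) (j : ℕ) (x : ℝ) :
    gkpFun (2 * d) κ Δ ε (2 * j) x = gkpFun d κ Δ ε j (x / √2) := by
  have hpos : 0 < √2 := Real.sqrt_pos.mpr two_pos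
  have hdiff (s : ℤ) :
      x - gkpCenter (2 * d) (2 * j) s = √2 * (x / √2 - gkpCenter d j s) := by
    rw [gkpCenter_two_mul, mul_sub, mul_div_cancel₀ _ hpos.ne']
  have hsqrt : √(2 * π * ↑(2 * d)) = √2 * √(2 * π * d) := by
    rw [← Real.sqrt_mul (by norm_num)]
    congr 1
    push_cast
    ring
  have hiff (s : ℤ) : |x - gkpCenter (2 * d) (2 * j) s| ≤ √(2 * π * ↑(2 * d)) * ε ↔
      |x / √2 - gkpCenter d j s| ≤ √(2 * π * d) * ε := by
    rw [hdiff, hsqrt, abs_mul, abs_of_pos hpos, mul_assoc, mul_le_mul_iff_right₀ hpos]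
  have hexp (s : ℤ) :
      -(x - gkpCenter (2 * d) (2 * j) s) ^ 2 / (4 * π * ↑(2 * d) * Δ ^ 2) =
        -(x / √2 - gkpCenter d j s) ^ 2 / (4 * π * d * Δ ^ 2) := by
    rw [hdiff, mul_pow, Real.sq_sqrt (by norm_num), ← mul_neg, Nat.cast_mul, Nat.cast_ofNat,
      show 4 * π * (2 * (d : ℝ)) * Δ ^ 2 = 2 * (4 * π * d * Δ ^ 2) by ring,
      mul_div_mul_left _ _ two_ne_zero]
  unfold gkpFun
  simp only [hexp, hiff]

/-- Dilating a function by `√2` multiplies its `L²` norm by `2 ^ (1 / 4)`. -/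
lemma sqrt_integral_sq_comp_div_sqrt_two (f : ℝ → ℝ) :
    √(∫ y, f (y / √2) ^ 2) = 2 ^ (1 / 4 : ℝ) * √(∫ y, f y ^ 2) := by
  rw [Measure.integral_comp_div (fun y => f y ^ 2), smul_eq_mul,
    abs_of_nonneg (Real.sqrt_nonneg 2), Real.sqrt_mul (Real.sqrt_nonneg 2)]
  congr 1
  rw [Real.sqrt_eq_rpow, Real.sqrt_eq_rpow, ← Real.rpow_mul two_pos.le]
  norm_num

/-- The squeezing (dilation) unitary `M_{√2}` on `L²(ℝ)`, `(M_{√2} f)(x) = 2^{−1/4} f(x/√2)`,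
maps the approximate GKP state encoding `j` in dimension `2^ℓ` exactly onto the approximate
GKP state encoding `2j` in dimension `2^{ℓ+1}`: the embedding isometry is implemented
without error. -/
theorem gkpState_embed (ℓ : ℕ) (hℓ : 1 ≤ ℓ) (κ Δ ε : ℝ)
    (hκ : 0 < κ) (hΔ : 0 < Δ) (hε : 0 < ε) (hε' : ε ≤ 1 / 2 ^ (ℓ + 1))
    (j : ℕ) (hj : j < 2 ^ ℓ) (x : ℝ) :
    (2 : ℝ) ^ (-(1 / 4 : ℝ)) * gkpState (2 ^ ℓ) κ Δ ε j (x / Real.sqrt 2) =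
      gkpState (2 ^ (ℓ + 1)) κ Δ ε (2 * j) x := by
  rw [pow_succ', gkpState, gkpState]
  simp only [gkpFun_two_mul]
  rw [sqrt_integral_sq_comp_div_sqrt_two (gkpFun (2 ^ ℓ) κ Δ ε j), Real.rpow_neg two_pos.le,
    ← div_eq_inv_mul, div_div, mul_comm (√_)]
end

section
/- Let ℓ ≥ 1, d = 2^ℓ, κ,Δ ∈ (0,1/4) and ε ∈ (0, 2^{−(ℓ+1)}]. For j,k ∈ {0,…,d−1} and b,b′ ∈ {0,1} define the real number M_{(j,b),(k,b′)} = δ_{b,b′}·((1−b)·δ_{j,k} + b·∫_ℝ ψ_j(x)·ψ_k(x − √(2π/d)) dx); this is the matrix element of the qubit-controlled translation W = I⊗|0⟩⟨0| + (translation by √(2π/d))⊗|1⟩⟨1| with respect to the basis ψ_j ⊗ |b⟩ of the span of the GKP states tensored with a qubit. Then for all j,k ∈ {0,…,d−1} and b,b′ ∈ {0,1}: (1 − κ²)·δ_{b,b′}·δ_{j, k⊕b} ≤ M_{(j,b),(k,b′)} ≤ δ_{b,b′}·δ_{j, k⊕b}, where ⊕ denotes addition modulo d. In particular, the matrix M has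 at most one nonzero entry in each row and column (it is 1-sparse). -/
open MeasureTheory Real
open scoped Classical

/-- Matrix element `M_{(j,b),(k,b′)} = δ_{b,b′}·((1−b)·δ_{j,k} + b·∫ ψ_j(x)·ψ_k(x − √(2π/d)) dx)`
of the qubit-controlled translation `W = I⊗|0⟩⟨0| + (translation by √(2π/d))⊗|1⟩⟨1|` in the
basis `ψ_j ⊗ |b⟩`. -/
noncomputable def ctrlShiftMat (d : ℕ) (κ Δ ε : ℝ)
    (p q : Fin d × Fin 2) : ℝ :=
  (if p.2 = q.2 then 1 else 0) *
    (((1 - (p.2 : ℕ) : ℕ) : ℝ) * (if p.1 = q.1 then 1 else 0) +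
      ((p.2 : ℕ) : ℝ) *
        ∫ x : ℝ, gkpState d κ Δ ε (p.1 : ℕ) x *
          gkpState d κ Δ ε (q.1 : ℕ) (x - Real.sqrt (2 * π / d)))

lemma gkpCenter_add (d j m : ℕ) (s : ℤ) :
    gkpCenter d (j + m) s = gkpCenter d j s + m * √(2 * π / d) := by
  unfold gkpCenter
  push_cast
  ring

lemma gkpCenter_sub_one (d j : ℕ) (s : ℤ) :
    gkpCenter d j (s - 1) = gkpCenter d j s - √(2 * π * d) := by
  unfold gkpCenter
  push_cast
  ring

lemma gkpPeriod_pos {d : ℕ} (hd : 0 < d) : 0 < √(2 * π * d) := by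
  positivity

lemma natCast_mul_gkpShift {d : ℕ} (hd : 0 < d) : d * √(2 * π / d) = √(2 * π * d) := by
  have hd' : (0 : ℝ) < d := by exact_mod_cast hd
  symm
  rw [Real.sqrt_eq_iff_mul_self_eq (by positivity) (by positivity), eq_comm]
  have h : √(2 * π / d) * √(2 * π / d) = 2 * π / d := Real.mul_self_sqrt (by positivity)
  calc (d : ℝ) * √(2 * π / d) * (d * √(2 * π / d))
      = d * d * (√(2 * π / d) * √(2 * π / d)) := by ring
    _ = 2 * π * d := by rw [h]; field_simp

/-- Integer indexing the peak of `gkpFun d κ Δ ε j` nearest to `x`. -/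
noncomputable def gkpPeak (d j : ℕ) (x : ℝ) : ℤ :=
  ⌊(x - √(2 * π / d) * j) / √(2 * π * d) + 1 / 2⌋

lemma gkpPeak_eq {d : ℕ} (hd : 0 < d) {ε : ℝ} (hε : ε < 1 / 2) {j : ℕ} {x : ℝ} {s : ℤ}
    (h : |x - gkpCenter d j s| ≤ √(2 * π * d) * ε) : gkpPeak d j x = s := by
  have hL := gkpPeriod_pos hd
  have h' : √(2 * π * d) * ε < √(2 * π * d) * (1 / 2) := by gcongr
  obtain ⟨h1, h2⟩ := abs_lt.mp (h.trans_lt h')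
  unfold gkpCenter at h1 h2
  rw [gkpPeak, Int.floor_eq_iff]
  constructor
  · rw [← sub_le_iff_le_add, le_div_iff₀ hL]
    linarith
  · rw [← lt_sub_iff_add_lt, div_lt_iff₀ hL]
    linarith

lemma gkpFun_of_near {d : ℕ} (hd : 0 < d) {κ Δ ε : ℝ} (hε : ε < 1 / 2) {j : ℕ} {x : ℝ} {s : ℤ}
    (h : |x - gkpCenter d j s| ≤ √(2 * π * d) * ε) :
    gkpFun d κ Δ ε j x = exp (-(κ ^ 2 * (s : ℝ) ^ 2) / 2) *
      exp (-(x - gkpCenter d j s) ^ 2 / (4 * π * d * Δ ^ 2)) := by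
  have hex : ∃ s : ℤ, |x - gkpCenter d j s| ≤ √(2 * π * d) * ε := ⟨s, h⟩
  have hs : hex.choose = s := (gkpPeak_eq hd hε hex.choose_spec).symm.trans (gkpPeak_eq hd hε h)
  rw [gkpFun, dif_pos hex, hs]

lemma gkpFun_nonneg (d : ℕ) (κ Δ ε : ℝ) (j : ℕ) (x : ℝ) : 0 ≤ gkpFun d κ Δ ε j x := by
  unfold gkpFun
  split_ifs <;> positivity

lemma exists_near_of_gkpFun_ne_zero {d : ℕ} {κ Δ ε : ℝ} {j : ℕ} {x : ℝ}
    (h : gkpFun d κ Δ ε j x ≠ 0) : ∃ s : ℤ, |x - gkpCenter d j s| ≤ √(2 * π * d) * ε := by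
  by_contra hex
  exact h (dif_neg hex)

lemma gkpFun_add (d : ℕ) (κ Δ ε : ℝ) (j m : ℕ) (x : ℝ) :
    gkpFun d κ Δ ε (j + m) x = gkpFun d κ Δ ε j (x - m * √(2 * π / d)) := by
  have h (s : ℤ) : x - gkpCenter d (j + m) s = x - m * √(2 * π / d) - gkpCenter d j s := by
    rw [gkpCenter_add]; ring
  simp only [gkpFun, h]

lemma gkpFun_eq_ite {d : ℕ} (hd : 0 < d) (κ Δ : ℝ) {ε : ℝ} (hε : ε < 1 / 2) (j : ℕ) :
    gkpFun d κ Δ ε j = fun x ↦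
      if |x - gkpCenter d j (gkpPeak d j x)| ≤ √(2 * π * d) * ε then
        exp (-(κ ^ 2 * (gkpPeak d j x : ℝ) ^ 2) / 2) *
          exp (-(x - gkpCenter d j (gkpPeak d j x)) ^ 2 / (4 * π * d * Δ ^ 2))
      else 0 := by
  funext x
  split_ifs with h
  · exact gkpFun_of_near hd hε h
  · by_contra hne
    obtain ⟨s, hs⟩ := exists_near_of_gkpFun_ne_zero hne
    rw [gkpPeak_eq hd hε hs] at h
    exact h hs

lemma measurable_gkpFun {d : ℕ} (hd : 0 < d) (κ Δ : ℝ) {ε : ℝ} (hε : ε < 1 / 2) (j : ℕ) :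
    Measurable (gkpFun d κ Δ ε j) := by
  have hp : Measurable fun x ↦ ((gkpPeak d j x : ℤ) : ℝ) := by
    have : Measurable (gkpPeak d j) := by
      unfold gkpPeak
      exact Int.measurable_floor.comp (by fun_prop)
    exact (measurable_of_countable (fun n : ℤ ↦ (n : ℝ))).comp this
  have hc : Measurable fun x ↦ gkpCenter d j (gkpPeak d j x) := by
    unfold gkpCenter
    fun_prop
  rw [gkpFun_eq_ite hd κ Δ hε]
  refine Measurable.ite (measurableSet_le (by fun_prop) measurable_const) ?_ measurable_const
  fun_prop

lemma gkpFun_sq_le {d : ℕ} (hd : 0 < d) (κ Δ : ℝ) {ε : ℝ} (hε : ε < 1 / 2) (j : ℕ) (x : ℝ) :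
    gkpFun d κ Δ ε j x ^ 2 ≤ exp (κ ^ 2 / 4) *
      exp (-(κ ^ 2 / (2 * √(2 * π * d) ^ 2)) * (x - √(2 * π / d) * j) ^ 2) := by
  by_cases h : gkpFun d κ Δ ε j x = 0
  · rw [h, zero_pow two_ne_zero]; positivity
  obtain ⟨s, hs⟩ := exists_near_of_gkpFun_ne_zero h
  have hL := gkpPeriod_pos hd
  rw [gkpFun_of_near hd hε hs]
  have h1 : exp (-(x - gkpCenter d j s) ^ 2 / (4 * π * d * Δ ^ 2)) ≤ 1 := by
    rw [Real.exp_le_one_iff, neg_div]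
    exact neg_nonpos.mpr (by positivity)
  have h' : √(2 * π * d) * ε ≤ √(2 * π * d) / 2 := by nlinarith
  have hsq : (x - gkpCenter d j s) ^ 2 ≤ (√(2 * π * d) / 2) ^ 2 :=
    sq_le_sq' (by linarith [(abs_le.mp hs).1]) (by linarith [(abs_le.mp hs).2])
  unfold gkpCenter at hsq
  have hexp : -(κ ^ 2 * (s : ℝ) ^ 2) ≤
      κ ^ 2 / 4 + -(κ ^ 2 / (2 * √(2 * π * d) ^ 2)) * (x - √(2 * π / d) * j) ^ 2 := by
    have key : (x - √(2 * π / d) * j) ^ 2 ≤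
        √(2 * π * d) ^ 2 * (2 * (s : ℝ) ^ 2 + 1 / 2) := by
      nlinarith [sq_nonneg (x - √(2 * π / d) * j - 2 * (√(2 * π * d) * s))]
    have : κ ^ 2 / (2 * √(2 * π * d) ^ 2) * (x - √(2 * π / d) * j) ^ 2 ≤
        κ ^ 2 / (2 * √(2 * π * d) ^ 2) * (√(2 * π * d) ^ 2 * (2 * (s : ℝ) ^ 2 + 1 / 2)) := by
      gcongr
    have e : κ ^ 2 / (2 * √(2 * π * d) ^ 2) * (√(2 * π * d) ^ 2 * (2 * (s : ℝ) ^ 2 + 1 / 2)) =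
        κ ^ 2 * (s : ℝ) ^ 2 + κ ^ 2 / 4 := by
      field_simp
      ring
    linarith
  calc (exp (-(κ ^ 2 * (s : ℝ) ^ 2) / 2) *
        exp (-(x - gkpCenter d j s) ^ 2 / (4 * π * d * Δ ^ 2))) ^ 2
      ≤ (exp (-(κ ^ 2 * (s : ℝ) ^ 2) / 2) * 1) ^ 2 := by gcongr
    _ = exp (-(κ ^ 2 * (s : ℝ) ^ 2)) := by
        rw [mul_one, ← Real.exp_nat_mul]
        congr 1
        push_cast
        ring
    _ ≤ _ := by
        rw [← Real.exp_add]
        exact Real.exp_le_exp.mpr hexp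

lemma integrable_gkpFun_sq {d : ℕ} (hd : 0 < d) {κ : ℝ} (hκ : 0 < κ) (Δ : ℝ) {ε : ℝ}
    (hε : ε < 1 / 2) (j : ℕ) : Integrable fun x ↦ gkpFun d κ Δ ε j x ^ 2 := by
  have hL := gkpPeriod_pos hd
  have hb : 0 < κ ^ 2 / (2 * √(2 * π * d) ^ 2) := by positivity
  refine (((integrable_exp_neg_mul_sq hb).comp_sub_right (√(2 * π / d) * j)).const_mul
    (exp (κ ^ 2 / 4))).mono' ((measurable_gkpFun hd κ Δ hε j).pow_const 2).aestronglyMeasurable ?_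
  filter_upwards with x
  rw [Real.norm_of_nonneg (sq_nonneg _)]
  exact gkpFun_sq_le hd κ Δ hε j x

lemma integrable_gkpFun_mul {d : ℕ} (hd : 0 < d) {κ : ℝ} (hκ : 0 < κ) (Δ : ℝ) {ε : ℝ}
    (hε : ε < 1 / 2) (j k : ℕ) :
    Integrable fun x ↦ gkpFun d κ Δ ε j x * gkpFun d κ Δ ε k x := by
  refine ((integrable_gkpFun_sq hd hκ Δ hε j).add (integrable_gkpFun_sq hd hκ Δ hε k)).mono'
    ((measurable_gkpFun hd κ Δ hε j).mul (measurable_gkpFun hd κ Δ hε k)).aestronglyMeasurable ?_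
  filter_upwards with x
  have hj := gkpFun_nonneg d κ Δ ε j x
  have hk := gkpFun_nonneg d κ Δ ε k x
  rw [Real.norm_of_nonneg (mul_nonneg hj hk), Pi.add_apply]
  nlinarith [sq_nonneg (gkpFun d κ Δ ε j x - gkpFun d κ Δ ε k x)]

lemma integral_gkpFun_sq (d : ℕ) (κ Δ ε : ℝ) (j : ℕ) :
    ∫ x, gkpFun d κ Δ ε j x ^ 2 = ∫ x, gkpFun d κ Δ ε 0 x ^ 2 := by
  have h (x : ℝ) := gkpFun_add d κ Δ ε 0 j x
  simp only [zero_add] at h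
  simp only [h]
  exact integral_sub_right_eq_self (fun x ↦ gkpFun d κ Δ ε 0 x ^ 2) _

lemma integral_gkpFun_sq_pos {d : ℕ} (hd : 0 < d) {κ : ℝ} (hκ : 0 < κ) (Δ : ℝ) {ε : ℝ}
    (hε : 0 < ε) (hε' : ε < 1 / 2) (j : ℕ) : 0 < ∫ x, gkpFun d κ Δ ε j x ^ 2 := by
  have hL := gkpPeriod_pos hd
  rw [integral_pos_iff_support_of_nonneg (fun x ↦ sq_nonneg _) (integrable_gkpFun_sq hd hκ Δ hε' j)]
  refine lt_of_lt_of_le (Metric.measure_ball_pos volume (gkpCenter d j 0) (mul_pos hL hε))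
    (measure_mono fun x hx ↦ ?_)
  rw [Metric.mem_ball, Real.dist_eq] at hx
  rw [Function.mem_support, gkpFun_of_near hd hε' hx.le]
  positivity

lemma integral_gkpFun_mul_le {d : ℕ} (hd : 0 < d) {κ : ℝ} (hκ : 0 < κ) (Δ : ℝ) {ε : ℝ}
    (hε : ε < 1 / 2) (j k : ℕ) :
    ∫ x, gkpFun d κ Δ ε j x * gkpFun d κ Δ ε k x ≤ ∫ x, gkpFun d κ Δ ε 0 x ^ 2 := by
  have hj := (integrable_gkpFun_sq hd hκ Δ hε j).div_const 2
  have hk := (integrable_gkpFun_sq hd hκ Δ hε k).div_const 2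
  calc ∫ x, gkpFun d κ Δ ε j x * gkpFun d κ Δ ε k x
      ≤ ∫ x, (gkpFun d κ Δ ε j x ^ 2 / 2 + gkpFun d κ Δ ε k x ^ 2 / 2) := by
        refine integral_mono (integrable_gkpFun_mul hd hκ Δ hε j k) (hj.add hk) fun x ↦ ?_
        dsimp only
        linarith [two_mul_le_add_sq (gkpFun d κ Δ ε j x) (gkpFun d κ Δ ε k x)]
    _ = ∫ x, gkpFun d κ Δ ε 0 x ^ 2 := by
        rw [integral_add hj hk, integral_div, integral_div, integral_gkpFun_sq d κ Δ ε j,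
          integral_gkpFun_sq d κ Δ ε k, add_halves]

/-- Shifting by a full period in either direction multiplies the envelope at peak `s` by
`exp (-κ² / 2 ± κ² s)`, and the average of the two factors is at least `exp (-κ² / 2)`. -/
lemma gkpFun_sq_le_mul_add {d : ℕ} (hd : 0 < d) (κ Δ : ℝ) {ε : ℝ} (hε : ε < 1 / 2) (j : ℕ)
    (x : ℝ) :
    2 * (1 - κ ^ 2) * gkpFun d κ Δ ε j x ^ 2 ≤
      gkpFun d κ Δ ε j x * gkpFun d κ Δ ε j (x - √(2 * π * d)) +
        gkpFun d κ Δ ε j x * gkpFun d κ Δ ε j (x + √(2 * π * d)) := by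
  by_cases h : gkpFun d κ Δ ε j x = 0
  · simp [h]
  obtain ⟨s, hs⟩ := exists_near_of_gkpFun_ne_zero h
  have e1 : x - √(2 * π * d) - gkpCenter d j (s - 1) = x - gkpCenter d j s := by
    rw [gkpCenter_sub_one]; ring
  have e2 : x + √(2 * π * d) - gkpCenter d j (s + 1) = x - gkpCenter d j s := by
    have := gkpCenter_sub_one d j (s + 1)
    rw [add_sub_cancel_right] at this
    rw [this]; ring
  rw [gkpFun_of_near hd hε hs, gkpFun_of_near hd hε (s := s - 1) (by rwa [e1]),
    gkpFun_of_near hd hε (s := s + 1) (by rwa [e2]), e1, e2]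
  set E := exp (-(x - gkpCenter d j s) ^ 2 / (4 * π * d * Δ ^ 2))
  set A := exp (-(κ ^ 2 * (s : ℝ) ^ 2) / 2) with hA
  have a1 : exp (-(κ ^ 2 * ((s - 1 : ℤ) : ℝ) ^ 2) / 2) = A * exp (-κ ^ 2 / 2 + κ ^ 2 * s) := by
    rw [hA, ← Real.exp_add]
    congr 1
    push_cast
    ring
  have a2 : exp (-(κ ^ 2 * ((s + 1 : ℤ) : ℝ) ^ 2) / 2) = A * exp (-κ ^ 2 / 2 - κ ^ 2 * s) := by
    rw [hA, ← Real.exp_add]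
    congr 1
    push_cast
    ring
  rw [a1, a2]
  have hfac : 2 * (1 - κ ^ 2) ≤
      exp (-κ ^ 2 / 2 + κ ^ 2 * s) + exp (-κ ^ 2 / 2 - κ ^ 2 * s) := by
    linarith [Real.add_one_le_exp (-κ ^ 2 / 2 + κ ^ 2 * s),
      Real.add_one_le_exp (-κ ^ 2 / 2 - κ ^ 2 * s), sq_nonneg κ]
  calc 2 * (1 - κ ^ 2) * (A * E) ^ 2
      ≤ (exp (-κ ^ 2 / 2 + κ ^ 2 * s) + exp (-κ ^ 2 / 2 - κ ^ 2 * s)) * (A * E) ^ 2 := by gcongr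
    _ = _ := by ring

lemma gkpFun_self_index {d : ℕ} (hd : 0 < d) (κ Δ ε : ℝ) (x : ℝ) :
    gkpFun d κ Δ ε d x = gkpFun d κ Δ ε 0 (x - √(2 * π * d)) := by
  have h := gkpFun_add d κ Δ ε 0 d x
  rwa [zero_add, natCast_mul_gkpShift hd] at h

lemma le_integral_gkpFun_zero_mul_self_index {d : ℕ} (hd : 0 < d) {κ : ℝ} (hκ : 0 < κ) (Δ : ℝ)
    {ε : ℝ} (hε : ε < 1 / 2) :
    (1 - κ ^ 2) * ∫ x, gkpFun d κ Δ ε 0 x ^ 2 ≤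
      ∫ x, gkpFun d κ Δ ε 0 x * gkpFun d κ Δ ε d x := by
  have i1 := integrable_gkpFun_mul hd hκ Δ hε 0 d
  simp only [gkpFun_self_index hd] at i1 ⊢
  have shift (x : ℝ) : gkpFun d κ Δ ε 0 (x + √(2 * π * d)) *
      gkpFun d κ Δ ε 0 (x + √(2 * π * d) - √(2 * π * d)) =
      gkpFun d κ Δ ε 0 x * gkpFun d κ Δ ε 0 (x + √(2 * π * d)) := by
    rw [add_sub_cancel_right, mul_comm]
  have i2 := i1.comp_add_right √(2 * π * d)
  simp only [shift] at i2
  have e := integral_add_right_eq_self (μ := volume)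
    (fun x ↦ gkpFun d κ Δ ε 0 x * gkpFun d κ Δ ε 0 (x - √(2 * π * d))) √(2 * π * d)
  simp only [shift] at e
  have key := integral_mono ((integrable_gkpFun_sq hd hκ Δ hε 0).const_mul (2 * (1 - κ ^ 2)))
    (i1.add i2) (gkpFun_sq_le_mul_add hd κ Δ hε 0)
  rw [integral_const_mul, integral_add' i1 i2, e] at key
  linarith

lemma integral_gkpFun_mul_eq_zero {d : ℕ} (hd : 0 < d) (κ Δ : ℝ) {ε : ℝ}
    (hε : ε ≤ 1 / (2 * d)) {j m : ℕ} (hjm : ¬ j ≡ m [MOD d]) :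
    ∫ x, gkpFun d κ Δ ε j x * gkpFun d κ Δ ε m x = 0 := by
  have hd' : (0 : ℝ) < d := by exact_mod_cast hd
  have hL := gkpPeriod_pos hd
  set L := √(2 * π * d) with hLdef
  have hδ : L = d * √(2 * π / d) := (natCast_mul_gkpShift hd).symm
  set δ := √(2 * π / d) with hδdef
  have hδ0 : 0 < δ := by
    rw [hδdef]
    positivity
  have hLε : L * ε ≤ δ / 2 := by
    calc L * ε ≤ L * (1 / (2 * d)) := by gcongr
      _ = δ / 2 := by rw [hδ]; field_simp
  let S : Set ℝ := Set.range (fun s : ℤ ↦ gkpCenter d j s + L * ε) ∪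
    Set.range (fun s : ℤ ↦ gkpCenter d j s - L * ε)
  have hS : S.Countable := (Set.countable_range _).union (Set.countable_range _)
  refine integral_eq_zero_of_ae ?_
  filter_upwards [hS.ae_notMem volume] with x hx
  by_contra hne
  obtain ⟨hj, hm⟩ := mul_ne_zero_iff.mp hne
  obtain ⟨s, hs⟩ := exists_near_of_gkpFun_ne_zero hj
  obtain ⟨t, ht⟩ := exists_near_of_gkpFun_ne_zero hm
  have hs' : |x - gkpCenter d j s| < L * ε := by
    refine lt_of_le_of_ne hs fun heq ↦ hx ?_
    rcases eq_or_eq_neg_of_abs_eq heq with h | h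
    · exact Or.inl ⟨s, by simp only; linarith⟩
    · exact Or.inr ⟨s, by simp only; linarith⟩
  have hcc : gkpCenter d j s - gkpCenter d m t = δ * ((d * (s - t) + j - m : ℤ) : ℝ) := by
    unfold gkpCenter
    rw [← hLdef, ← hδdef, hδ]
    push_cast
    ring
  have hlt : |δ * ((d * (s - t) + j - m : ℤ) : ℝ)| < δ := by
    rw [← hcc, abs_lt]
    obtain ⟨h1, h2⟩ := abs_lt.mp hs'
    obtain ⟨h3, h4⟩ := abs_le.mp ht
    constructor <;> linarith
  rw [abs_mul, abs_of_pos hδ0] at hlt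
  have habs : |((d * (s - t) + j - m : ℤ) : ℝ)| < 1 := by
    by_contra! hge
    nlinarith
  rw [← Int.cast_abs] at habs
  have hzero : (d * (s - t) + j - m : ℤ) = 0 := Int.abs_lt_one_iff.mp (by exact_mod_cast habs)
  refine hjm ((Nat.modEq_iff_dvd).mpr ⟨s - t, ?_⟩)
  linarith

lemma integral_gkpState_mul_shift (d : ℕ) (κ Δ ε : ℝ) (j k : ℕ) :
    ∫ x, gkpState d κ Δ ε j x * gkpState d κ Δ ε k (x - √(2 * π / d)) =
      (∫ x, gkpFun d κ Δ ε j x * gkpFun d κ Δ ε (k + 1) x) / ∫ x, gkpFun d κ Δ ε 0 x ^ 2 := by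
  have hN : 0 ≤ ∫ x, gkpFun d κ Δ ε 0 x ^ 2 := integral_nonneg fun x ↦ sq_nonneg _
  rw [← integral_div]
  refine integral_congr_ae (.of_forall fun x ↦ ?_)
  simp only [gkpState]
  rw [integral_gkpFun_sq d κ Δ ε j, integral_gkpFun_sq d κ Δ ε k, gkpFun_add d κ Δ ε k 1 x,
    div_mul_div_comm, Real.mul_self_sqrt hN, Nat.cast_one, one_mul]

/-- Overlap bounds for a GKP state with the translate of another one. -/
lemma integral_gkpState_mul_shift_bounds {d : ℕ} (hd : 2 ≤ d) {κ : ℝ} (hκ : 0 < κ) (Δ : ℝ) {ε : ℝ}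
    (hε : 0 < ε) (hε' : ε ≤ 1 / (2 * d)) {j k : ℕ} (hj : j < d) (hk : k < d) :
    (1 - κ ^ 2) * (if j = (k + 1) % d then 1 else 0) ≤
        ∫ x, gkpState d κ Δ ε j x * gkpState d κ Δ ε k (x - √(2 * π / d)) ∧
      ∫ x, gkpState d κ Δ ε j x * gkpState d κ Δ ε k (x - √(2 * π / d)) ≤
        if j = (k + 1) % d then 1 else 0 := by
  have hd0 : 0 < d := by omega
  have hε2 : ε < 1 / 2 := by
    have : (2 : ℝ) ≤ d := by exact_mod_cast hd
    refine hε'.trans_lt ?_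
    gcongr
    linarith
  have hN := integral_gkpFun_sq_pos hd0 hκ Δ hε hε2 0
  rw [integral_gkpState_mul_shift]
  split_ifs with h
  · rw [mul_one, le_div_iff₀ hN, div_le_one hN]
    refine ⟨?_, integral_gkpFun_mul_le hd0 hκ Δ hε2 _ _⟩
    rcases (show k + 1 ≤ d from hk).lt_or_eq with hlt | heq
    · rw [Nat.mod_eq_of_lt hlt] at h
      rw [← h]
      simp only [← pow_two]
      rw [integral_gkpFun_sq d κ Δ ε j]
      nlinarith [sq_nonneg κ]
    · rw [heq, Nat.mod_self] at h
      rw [h, heq]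
      exact le_integral_gkpFun_zero_mul_self_index hd0 hκ Δ hε2
  · rw [integral_gkpFun_mul_eq_zero hd0 κ Δ hε' (fun hmod ↦ h ?_)]
    · simp
    · rw [← Nat.mod_eq_of_lt hj]
      exact hmod

/-- Two-sided bound for the matrix elements of the qubit-controlled translation in the
approximate GKP code (`d = 2^ℓ`), and 1-sparsity of the resulting matrix. Here `⊕` is
addition modulo `d`, i.e. `j = (k + b) mod d`. -/
theorem gkp_ctrlShift_matrix_bounds (ℓ : ℕ) (hℓ : 1 ≤ ℓ) (κ Δ ε : ℝ)
    (hκ : 0 < κ) (hκ' : κ < 1 / 4) (hΔ : 0 < Δ) (hΔ' : Δ < 1 / 4)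
    (hε : 0 < ε) (hε' : ε ≤ 1 / 2 ^ (ℓ + 1)) :
    (∀ (j k : Fin (2 ^ ℓ)) (b b' : Fin 2),
      (1 - κ ^ 2) * ((if b = b' then 1 else 0) *
          (if (j : ℕ) = ((k : ℕ) + (b : ℕ)) % 2 ^ ℓ then 1 else 0)) ≤
        ctrlShiftMat (2 ^ ℓ) κ Δ ε (j, b) (k, b') ∧
      ctrlShiftMat (2 ^ ℓ) κ Δ ε (j, b) (k, b') ≤
        (if b = b' then 1 else 0) *
          (if (j : ℕ) = ((k : ℕ) + (b : ℕ)) % 2 ^ ℓ then 1 else 0)) ∧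
    (∀ p : Fin (2 ^ ℓ) × Fin 2,
      {q : Fin (2 ^ ℓ) × Fin 2 | ctrlShiftMat (2 ^ ℓ) κ Δ ε p q ≠ 0}.ncard ≤ 1) ∧
    (∀ q : Fin (2 ^ ℓ) × Fin 2,
      {p : Fin (2 ^ ℓ) × Fin 2 | ctrlShiftMat (2 ^ ℓ) κ Δ ε p q ≠ 0}.ncard ≤ 1) := by
  have hd : 2 ≤ 2 ^ ℓ := by
    calc 2 = 2 ^ 1 := (pow_one 2).symm
      _ ≤ 2 ^ ℓ := Nat.pow_le_pow_right (by norm_num) hℓ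
  have hεd : ε ≤ 1 / (2 * ((2 ^ ℓ : ℕ) : ℝ)) := by
    push_cast
    rwa [← pow_succ']
  have bounds (j k : Fin (2 ^ ℓ)) (b b' : Fin 2) :
      (1 - κ ^ 2) * ((if b = b' then 1 else 0) *
          (if (j : ℕ) = ((k : ℕ) + (b : ℕ)) % 2 ^ ℓ then 1 else 0)) ≤
        ctrlShiftMat (2 ^ ℓ) κ Δ ε (j, b) (k, b') ∧
      ctrlShiftMat (2 ^ ℓ) κ Δ ε (j, b) (k, b') ≤
        (if b = b' then 1 else 0) *
          (if (j : ℕ) = ((k : ℕ) + (b : ℕ)) % 2 ^ ℓ then 1 else 0) := by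
    unfold ctrlShiftMat
    by_cases hb : b = b'
    · subst hb
      fin_cases b
      · by_cases hjk : j = k
        · simp [hjk, Nat.mod_eq_of_lt k.isLt, sq_nonneg]
        · simp [hjk, Nat.mod_eq_of_lt k.isLt, Fin.val_inj]
      · simpa using integral_gkpState_mul_shift_bounds hd hκ Δ hε hεd j.isLt k.isLt
    · simp [hb]
  have support {p q : Fin (2 ^ ℓ) × Fin 2} (h : ctrlShiftMat (2 ^ ℓ) κ Δ ε p q ≠ 0) :
      p.2 = q.2 ∧ (p.1 : ℕ) = ((q.1 : ℕ) + (p.2 : ℕ)) % 2 ^ ℓ := by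
    have hpq := bounds p.1 q.1 p.2 q.2
    by_contra hne
    refine h (le_antisymm ?_ ?_)
    · refine hpq.2.trans_eq ?_
      rcases not_and_or.mp hne with hn | hn <;> simp [hn]
    · refine le_of_eq_of_le ?_ hpq.1
      rcases not_and_or.mp hne with hn | hn <;> simp [hn]
  refine ⟨bounds, fun p ↦ ?_, fun q ↦ ?_⟩
  · rw [Set.ncard_le_one_iff]
    intro q r hq hr
    obtain ⟨hq2, hq1⟩ := support hq
    obtain ⟨hr2, hr1⟩ := support hr
    have hmod : (q.1 : ℕ) ≡ r.1 [MOD 2 ^ ℓ] :=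
      Nat.ModEq.add_right_cancel' (p.2 : ℕ) (hq1.symm.trans hr1)
    exact Prod.ext (Fin.ext (hmod.eq_of_lt_of_lt q.1.isLt r.1.isLt)) (hq2.symm.trans hr2)
  · rw [Set.ncard_le_one_iff]
    intro p r hp hr
    obtain ⟨hp2, hp1⟩ := support hp
    obtain ⟨hr2, hr1⟩ := support hr
    have h2 : p.2 = r.2 := hp2.trans hr2.symm
    exact Prod.ext (Fin.ext (by rw [hp1, hr1, h2])) h2
end

section
/- Let z ∈ ℤ, let L ≥ 2 be an even integer, let Δ > 0 and ε ∈ (0,1/2). Then the real part of ∫_ℝ (Sha^ε_{L,Δ}(x))² · e^{2πizx} dx is at least 1 − 10·z²·Δ² − 16·(Δ/ε)⁴. (Equivalently, ⟨Sha^ε_{L,Δ}, e^{2πizQ} Sha^ε_{L,Δ}⟩ ≥ 1 − 10z²Δ² − 16(Δ/ε)⁴, where e^{2πizQ} is multiplication by e^{2πizx}.) -/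
open MeasureTheory Real

/-- The unnormalized truncated Gaussian: `e^{−x²/(2Δ²)}` for `|x| ≤ ε` and `0` otherwise. -/
noncomputable def truncGauss (Δ ε : ℝ) (x : ℝ) : ℝ :=
  if |x| ≤ ε then Real.exp (-x ^ 2 / (2 * Δ ^ 2)) else 0

/-- The normalized truncated Gaussian `Ψ^ε_Δ`, with unit `L²(ℝ)`-norm. -/
noncomputable def truncGaussNorm (Δ ε : ℝ) (x : ℝ) : ℝ :=
  truncGauss Δ ε x / Real.sqrt (∫ y : ℝ, truncGauss Δ ε y ^ 2)

/-- The rectangular-envelope GKP (comb) state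
`Sha^ε_{L,Δ} = L^{−1/2}·Σ_{z=−L/2}^{L/2−1} Ψ^ε_Δ(· − z)`. -/
noncomputable def shaState (L : ℕ) (Δ ε : ℝ) (x : ℝ) : ℝ :=
  (Real.sqrt L)⁻¹ *
    ∑ z ∈ Finset.Icc (-(L : ℤ) / 2) ((L : ℤ) / 2 - 1), truncGaussNorm Δ ε (x - z)

/-- The square of the truncated Gaussian, as an indicator function. -/
theorem truncGauss_sq (Δ ε x : ℝ) :
    truncGauss Δ ε x ^ 2 =
      (Set.Icc (-ε) ε).indicator (fun y => Real.exp (-y ^ 2 / Δ ^ 2)) x := by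
  unfold truncGauss
  by_cases h : |x| ≤ ε
  · rw [if_pos h, Set.indicator_of_mem (Set.mem_Icc.2 (abs_le.1 h)), ← Real.exp_nat_mul]
    congr 1
    push_cast
    rw [mul_comm 2 (Δ ^ 2), ← div_div]
    ring
  · have hx : x ∉ Set.Icc (-ε) ε := fun hx => h (abs_le.2 hx)
    rw [if_neg h, Set.indicator_of_notMem hx]
    norm_num

theorem truncGauss_sq_mul (Δ ε : ℝ) (h : ℝ → ℝ) :
    (fun x => truncGauss Δ ε x ^ 2 * h x) =
      (Set.Icc (-ε) ε).indicator (fun y => Real.exp (-y ^ 2 / Δ ^ 2) * h y) := by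
  funext x
  rw [truncGauss_sq, Set.indicator_mul_left]

theorem integrable_truncGauss_sq_mul (Δ ε : ℝ) {h : ℝ → ℝ} (hh : Continuous h) :
    Integrable (fun x => truncGauss Δ ε x ^ 2 * h x) := by
  rw [truncGauss_sq_mul, integrable_indicator_iff measurableSet_Icc]
  exact Continuous.integrableOn_Icc (by fun_prop)

theorem integral_truncGauss_sq_mul (Δ : ℝ) {ε : ℝ} (hε : 0 < ε) (h : ℝ → ℝ) :
    ∫ x, truncGauss Δ ε x ^ 2 * h x =
      ∫ x in (-ε)..ε, Real.exp (-x ^ 2 / Δ ^ 2) * h x := by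
  rw [truncGauss_sq_mul, integral_indicator measurableSet_Icc, integral_Icc_eq_integral_Ioc,
    intervalIntegral.integral_of_le (by linarith)]

theorem integral_truncGauss_sq_pos (Δ : ℝ) {ε : ℝ} (hε : 0 < ε) :
    0 < ∫ x, truncGauss Δ ε x ^ 2 := by
  have h := integral_truncGauss_sq_mul Δ hε (fun _ => 1)
  simp only [mul_one] at h
  rw [h]
  exact intervalIntegral.intervalIntegral_pos_of_pos
    (Continuous.intervalIntegrable (by fun_prop) _ _) (fun x => Real.exp_pos _) (by linarith)

/-- Truncation does not increase the second moment of the Gaussian. -/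
theorem integral_truncGauss_sq_mul_sq_le {Δ ε : ℝ} (hΔ : 0 < Δ) (hε : 0 < ε) :
    ∫ x, truncGauss Δ ε x ^ 2 * x ^ 2 ≤ Δ ^ 2 / 2 * ∫ x, truncGauss Δ ε x ^ 2 := by
  have h := integral_truncGauss_sq_mul Δ hε (fun _ => 1)
  simp only [mul_one] at h
  rw [h, integral_truncGauss_sq_mul Δ hε (fun x => x ^ 2), ← sub_nonneg,
    ← intervalIntegral.integral_const_mul, ← intervalIntegral.integral_sub
      (Continuous.intervalIntegrable (by fun_prop) _ _)
      (Continuous.intervalIntegrable (by fun_prop) _ _)]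
  have hd : ∀ x ∈ Set.uIcc (-ε) ε, HasDerivAt
      (fun y => Δ ^ 2 / 2 * (y * Real.exp (-y ^ 2 / Δ ^ 2)))
      (Δ ^ 2 / 2 * Real.exp (-x ^ 2 / Δ ^ 2) - Real.exp (-x ^ 2 / Δ ^ 2) * x ^ 2) x := by
    intro x _
    have h1 : HasDerivAt (fun y : ℝ => -y ^ 2 / Δ ^ 2) (-(2 * x) / Δ ^ 2) x := by
      simpa using (hasDerivAt_pow 2 x).neg.div_const (Δ ^ 2)
    refine (((hasDerivAt_id' x).mul h1.exp).const_mul (Δ ^ 2 / 2)).congr_deriv ?_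
    field_simp
    ring
  rw [intervalIntegral.integral_eq_sub_of_hasDerivAt hd
    (Continuous.intervalIntegrable (by fun_prop) _ _)]
  have := Real.exp_pos (-ε ^ 2 / Δ ^ 2)
  rw [neg_sq, neg_mul, mul_neg, sub_neg_eq_add]
  positivity

theorem truncGaussNorm_sq (Δ ε x : ℝ) :
    truncGaussNorm Δ ε x ^ 2 = truncGauss Δ ε x ^ 2 / ∫ y, truncGauss Δ ε y ^ 2 := by
  rw [truncGaussNorm, div_pow, Real.sq_sqrt (integral_nonneg fun y => sq_nonneg _)]

theorem truncGaussNorm_mul_eq_zero {Δ ε : ℝ} (hε : ε < 1 / 2) {j k : ℤ} (hjk : j ≠ k) (x : ℝ) :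
    truncGaussNorm Δ ε (x - j) * truncGaussNorm Δ ε (x - k) = 0 := by
  unfold truncGaussNorm truncGauss
  by_cases hj : |x - j| ≤ ε
  · by_cases hk : |x - k| ≤ ε
    · have h1 : (1 : ℝ) ≤ |(j : ℝ) - k| := by
        exact_mod_cast Int.one_le_abs (sub_ne_zero.2 hjk)
      have h2 : |(j : ℝ) - k| ≤ |x - k| + |x - j| := by
        simpa using abs_sub (x - k) (x - j)
      linarith
    · simp [if_neg hk]
  · simp [if_neg hj]

/-- The teeth of the comb have disjoint supports, so the square of the comb state is the
average of the squared teeth. -/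
theorem shaState_sq (L : ℕ) (Δ : ℝ) {ε : ℝ} (hε : ε < 1 / 2) (x : ℝ) :
    shaState L Δ ε x ^ 2 = (L : ℝ)⁻¹ *
      ∑ k ∈ Finset.Icc (-(L : ℤ) / 2) ((L : ℤ) / 2 - 1), truncGaussNorm Δ ε (x - k) ^ 2 := by
  rw [shaState, mul_pow, inv_pow, Real.sq_sqrt (Nat.cast_nonneg L), sq (Finset.sum _ _),
    Finset.sum_mul_sum]
  congr 1
  refine Finset.sum_congr rfl fun j hj => ?_
  rw [Finset.sum_eq_single_of_mem j hj
    fun k _ hk => truncGaussNorm_mul_eq_zero hε hk.symm x, sq]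

theorem integrable_truncGaussNorm_sq_mul_exp (Δ ε : ℝ) (z : ℤ) :
    Integrable (fun x : ℝ => ((truncGaussNorm Δ ε x : ℝ) : ℂ) ^ 2 *
      Complex.exp (2 * (π : ℂ) * Complex.I * (z : ℂ) * (x : ℂ))) := by
  have h : Integrable (fun x : ℝ => ((truncGaussNorm Δ ε x ^ 2 : ℝ) : ℂ)) := by
    have h1 := (integrable_truncGauss_sq_mul Δ ε (continuous_const (y := (1 : ℝ)))).div_const
      (∫ y, truncGauss Δ ε y ^ 2)
    simp only [mul_one] at h1
    simp only [truncGaussNorm_sq]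
    exact h1.ofReal
  simp only [Complex.ofReal_pow] at h
  refine h.mul_bdd (c := 1) (Continuous.aestronglyMeasurable (by fun_prop))
    (ae_of_all _ fun x => ?_)
  rw [Complex.norm_exp]
  simp

/-- Integer translates of a tooth have the same overlap with an integer-frequency character, so
the overlap of the comb equals that of a single tooth. -/
theorem integral_shaState_sq_mul_exp {L : ℕ} (hL : 0 < L) (hLeven : Even L) (Δ : ℝ) {ε : ℝ}
    (hε : ε < 1 / 2) (z : ℤ) :
    ∫ x : ℝ, ((shaState L Δ ε x : ℝ) : ℂ) ^ 2 *
        Complex.exp (2 * (π : ℂ) * Complex.I * (z : ℂ) * (x : ℂ)) =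
      ∫ x : ℝ, ((truncGaussNorm Δ ε x : ℝ) : ℂ) ^ 2 *
        Complex.exp (2 * (π : ℂ) * Complex.I * (z : ℂ) * (x : ℂ)) := by
  set G : ℝ → ℂ := fun x => ((truncGaussNorm Δ ε x : ℝ) : ℂ) ^ 2 *
    Complex.exp (2 * (π : ℂ) * Complex.I * (z : ℂ) * (x : ℂ)) with hG
  have hGi : Integrable G := integrable_truncGaussNorm_sq_mul_exp Δ ε z
  have hexp : ∀ (x : ℝ) (k : ℤ),
      Complex.exp (2 * (π : ℂ) * Complex.I * (z : ℂ) * ((x - k : ℝ) : ℂ)) =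
        Complex.exp (2 * (π : ℂ) * Complex.I * (z : ℂ) * (x : ℂ)) := by
    intro x k
    rw [Complex.exp_eq_exp_iff_exists_int]
    exact ⟨-(z * k), by push_cast; ring⟩
  have hpt : ∀ x : ℝ, ((shaState L Δ ε x : ℝ) : ℂ) ^ 2 *
      Complex.exp (2 * (π : ℂ) * Complex.I * (z : ℂ) * (x : ℂ)) =
      (L : ℂ)⁻¹ * ∑ k ∈ Finset.Icc (-(L : ℤ) / 2) ((L : ℤ) / 2 - 1), G (x - k) := by
    intro x
    rw [← Complex.ofReal_pow, shaState_sq L Δ hε]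
    simp only [hG, hexp, ← Finset.sum_mul]
    push_cast
    ring
  have hcard : (Finset.Icc (-(L : ℤ) / 2) ((L : ℤ) / 2 - 1)).card = L := by
    obtain ⟨m, rfl⟩ := hLeven
    rw [Int.card_Icc]
    omega
  simp only [hpt]
  rw [integral_const_mul, integral_finsetSum _ fun (k : ℤ) _ => hGi.comp_sub_right (k : ℝ)]
  simp only [integral_sub_right_eq_self G, Finset.sum_const, hcard, nsmul_eq_mul]
  rw [inv_mul_cancel_left₀ (by exact_mod_cast hL.ne')]

theorem re_integral_truncGaussNorm_sq_mul_exp (Δ ε : ℝ) (z : ℤ) :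
    (∫ x : ℝ, ((truncGaussNorm Δ ε x : ℝ) : ℂ) ^ 2 *
        Complex.exp (2 * (π : ℂ) * Complex.I * (z : ℂ) * (x : ℂ))).re =
      (∫ x, truncGauss Δ ε x ^ 2 * Real.cos (2 * π * z * x)) /
        ∫ x, truncGauss Δ ε x ^ 2 := by
  rw [← RCLike.re_eq_complex_re, ← integral_re (integrable_truncGaussNorm_sq_mul_exp Δ ε z),
    ← integral_div]
  refine integral_congr_ae (ae_of_all _ fun x => ?_)
  have h : 2 * (π : ℂ) * Complex.I * (z : ℂ) * (x : ℂ) =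
      ((2 * π * z * x : ℝ) : ℂ) * Complex.I := by
    push_cast
    ring
  simp only [RCLike.re_eq_complex_re]
  rw [h, ← Complex.ofReal_pow, Complex.re_ofReal_mul, Complex.exp_ofReal_mul_I_re,
    truncGaussNorm_sq]
  ring

theorem one_sub_le_re_integral_truncGaussNorm_sq_mul_exp {Δ ε : ℝ} (hΔ : 0 < Δ) (hε : 0 < ε)
    (z : ℤ) :
    1 - π ^ 2 * (z : ℝ) ^ 2 * Δ ^ 2 ≤
      (∫ x : ℝ, ((truncGaussNorm Δ ε x : ℝ) : ℂ) ^ 2 *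
        Complex.exp (2 * (π : ℂ) * Complex.I * (z : ℂ) * (x : ℂ))).re := by
  rw [re_integral_truncGaussNorm_sq_mul_exp, le_div_iff₀ (integral_truncGauss_sq_pos Δ hε)]
  have h1 := integrable_truncGauss_sq_mul Δ ε (continuous_const (y := (1 : ℝ)))
  simp only [mul_one] at h1
  have h2 := (integrable_truncGauss_sq_mul Δ ε (continuous_pow 2)).const_mul
    (2 * π ^ 2 * (z : ℝ) ^ 2)
  calc (1 - π ^ 2 * (z : ℝ) ^ 2 * Δ ^ 2) * ∫ x, truncGauss Δ ε x ^ 2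
      = (∫ x, truncGauss Δ ε x ^ 2) - 2 * π ^ 2 * (z : ℝ) ^ 2 *
          (Δ ^ 2 / 2 * ∫ x, truncGauss Δ ε x ^ 2) := by ring
    _ ≤ (∫ x, truncGauss Δ ε x ^ 2) - 2 * π ^ 2 * (z : ℝ) ^ 2 *
          ∫ x, truncGauss Δ ε x ^ 2 * x ^ 2 := by
        gcongr
        exact integral_truncGauss_sq_mul_sq_le hΔ hε
    _ = ∫ x, (truncGauss Δ ε x ^ 2 -
          2 * π ^ 2 * (z : ℝ) ^ 2 * (truncGauss Δ ε x ^ 2 * x ^ 2)) := by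
        rw [integral_sub h1 h2, integral_const_mul]
    _ ≤ ∫ x, truncGauss Δ ε x ^ 2 * Real.cos (2 * π * z * x) := by
        refine integral_mono (h1.sub h2)
          (integrable_truncGauss_sq_mul Δ ε (by fun_prop)) fun x => ?_
        have h := mul_le_mul_of_nonneg_left
          (Real.one_sub_sq_div_two_le_cos (x := 2 * π * z * x)) (sq_nonneg (truncGauss Δ ε x))
        refine le_trans (le_of_eq ?_) h
        ring

/-- `⟨Sha^ε_{L,Δ}, e^{2πizQ} Sha^ε_{L,Δ}⟩ ≥ 1 − 10z²Δ² − 16(Δ/ε)⁴`: the real part of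
`∫ (Sha^ε_{L,Δ}(x))² e^{2πizx} dx` is at least `1 − 10·z²·Δ² − 16·(Δ/ε)⁴`. -/
theorem sha_momentum_translation_overlap (z : ℤ) (L : ℕ) (hL : 2 ≤ L) (hLeven : Even L)
    (Δ ε : ℝ) (hΔ : 0 < Δ) (hε : 0 < ε) (hε' : ε < 1 / 2) :
    1 - 10 * (z : ℝ) ^ 2 * Δ ^ 2 - 16 * (Δ / ε) ^ 4 ≤
      (∫ x : ℝ, ((shaState L Δ ε x : ℝ) : ℂ) ^ 2 *
        Complex.exp (2 * (π : ℂ) * Complex.I * (z : ℂ) * (x : ℂ))).re := by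
  rw [integral_shaState_sq_mul_exp (by omega) hLeven Δ hε' z]
  refine le_trans ?_ (one_sub_le_re_integral_truncGaussNorm_sq_mul_exp hΔ hε z)
  have hπ : π ^ 2 ≤ 10 := by nlinarith [Real.pi_pos, Real.pi_lt_d2]
  have h1 : π ^ 2 * ((z : ℝ) ^ 2 * Δ ^ 2) ≤ 10 * ((z : ℝ) ^ 2 * Δ ^ 2) := by gcongr
  have h2 : 0 ≤ (Δ / ε) ^ 4 := by positivity
  linarith
end

section
/- Let α > 0 with α ≠ 1. Set n = ⌈|ln α|⌉ and α′ = exp((ln α)/n). Then (α′)^n = α, |ln α′| ≤ 1, and for every function f : ℝ → ℂ and every x ∈ ℝ: ((D_{1/α′})^{∘n} ∘ E ∘ (D_{α′})^{∘n})(f)(x) = e^{iαx}·f(x), where for β > 0 the unitary dilation (squeezing) operator D_β is defined by (D_β g)(x) = β^{−1/2}·g(x/β) and E is multiplication by e^{ix}, (E g)(x) = e^{ix}·g(x). In operator form, the unbounded-strength displacement e^{iαQ} equals (M_{α′}^†)^n e^{iQ} (M_{α′})^n, decomposing it into 2n+1 constant-strength elementary operations. -/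
open Real

/-- The unitary dilation (squeezing) operator `D_β = M_β` on functions on `ℝ`:
`(D_β g)(x) = β^{−1/2}·g(x/β)`. -/
noncomputable def dilOp (β : ℝ) (g : ℝ → ℂ) : ℝ → ℂ :=
  fun x => ((Real.sqrt β)⁻¹ : ℝ) * g (x / β)

/-- Multiplication by `e^{ix}`, i.e. the constant-strength displacement `e^{iQ}`. -/
noncomputable def mulExpI (g : ℝ → ℂ) : ℝ → ℂ :=
  fun x => Complex.exp (Complex.I * x) * g x

theorem dilOp_iterate_apply {β : ℝ} (hβ : 0 < β) (n : ℕ) (g : ℝ → ℂ) (x : ℝ) :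
    (dilOp β)^[n] g x = dilOp (β ^ n) g x := by
  induction n generalizing g with
  | zero => simp [dilOp]
  | succ n ih =>
    rw [Function.iterate_succ_apply, ih]
    simp only [dilOp]
    rw [pow_succ, Real.sqrt_mul (pow_nonneg hβ.le n), mul_inv, div_div]
    push_cast
    ring

theorem dilOp_inv_mulExpI_dilOp {α : ℝ} (hα : 0 < α) (f : ℝ → ℂ) (x : ℝ) :
    dilOp α⁻¹ (mulExpI (dilOp α f)) x = Complex.exp (Complex.I * α * x) * f x := by
  have hsqrt : (√α : ℂ) ≠ 0 := Complex.ofReal_ne_zero.mpr (Real.sqrt_pos.mpr hα).ne'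
  have hx : x / α⁻¹ = α * x := by rw [div_inv_eq_mul, mul_comm]
  simp only [dilOp, mulExpI, hx, mul_div_cancel_left₀ x hα.ne', Real.sqrt_inv, inv_inv]
  push_cast
  rw [mul_assoc Complex.I]
  field_simp

/-- The unbounded-strength displacement `e^{iαQ}` equals `(M_{α′}^†)^n e^{iQ} (M_{α′})^n`
with `n = ⌈|ln α|⌉` and `α′ = exp((ln α)/n)`: it decomposes into `2n+1` constant-strength
elementary operations.  Moreover `(α′)^n = α` and `|ln α′| ≤ 1`. -/
theorem displacement_decomposition (α : ℝ) (hα : 0 < α) (hα1 : α ≠ 1) :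
    (Real.exp (Real.log α / (⌈|Real.log α|⌉₊ : ℝ))) ^ ⌈|Real.log α|⌉₊ = α ∧
    |Real.log (Real.exp (Real.log α / (⌈|Real.log α|⌉₊ : ℝ)))| ≤ 1 ∧
    ∀ (f : ℝ → ℂ) (x : ℝ),
      (dilOp (1 / Real.exp (Real.log α / (⌈|Real.log α|⌉₊ : ℝ))))^[⌈|Real.log α|⌉₊]
          (mulExpI
            ((dilOp (Real.exp (Real.log α / (⌈|Real.log α|⌉₊ : ℝ))))^[⌈|Real.log α|⌉₊] f))
          x =
        Complex.exp (Complex.I * α * x) * f x := by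
  have hlog : Real.log α ≠ 0 := Real.log_ne_zero_of_pos_of_ne_one hα hα1
  have hn : 0 < ⌈|Real.log α|⌉₊ := Nat.ceil_pos.mpr (abs_pos.mpr hlog)
  have hle : |Real.log α| ≤ (⌈|Real.log α|⌉₊ : ℝ) := Nat.le_ceil _
  generalize ⌈|Real.log α|⌉₊ = n at hn hle ⊢
  have hn' : (0 : ℝ) < n := Nat.cast_pos.mpr hn
  have hpow : Real.exp (Real.log α / n) ^ n = α := by
    rw [← Real.exp_nat_mul, mul_div_cancel₀ _ hn'.ne', Real.exp_log hα]
  refine ⟨hpow, ?_, fun f x => ?_⟩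
  · rw [Real.log_exp, abs_div, abs_of_pos hn']
    exact div_le_one_of_le₀ hle hn'.le
  · have hdil : (dilOp (Real.exp (Real.log α / n)))^[n] f = dilOp α f := by
      funext y
      rw [dilOp_iterate_apply (Real.exp_pos _), hpow]
    rw [hdil, dilOp_iterate_apply (one_div_pos.mpr (Real.exp_pos _)), one_div, inv_pow, hpow,
      dilOp_inv_mulExpI_dilOp hα]
end
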